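/- Fix real parameters M>0, l>0, a with |a|<l, and α<9/4, and let E ∈ (1/l², V_max). Then there exist sequences of real numbers (ωₙ²) and (μₙ), nonzero twice continuously differentiable functions uₙ : [x_max, π/2) → ℝ, and nonzero smooth bounded functions Sₙ : (0,π) → ℝ such that for every n: (i) −uₙ″(x) + (μₙ·V_σ(R(x)) + V_junk(R(x)) + V_mass(R(x)))·uₙ(x) = ωₙ²·uₙ(x) for all x ∈ (x_max, π/2), with uₙ(x_max) = 0 and ∫_{x_max}^{π/2} (|uₙ′(x)|² + R(x)²·uₙ(x)²) dx < ∞; (ii) Sₙ satisfies the angular equation −(1/sin θ)·d/dθ(Δ_θ · sin θ · Sₙ′(θ)) + (|α|/l²)·a²·c_α(θ)·Sₙ(θ) + (sin²θ/Δ_θ)·a²·ωₙ²·Sₙ(θ) = μₙ·Sₙ(θ) on (0,π), with sin θ · Sₙ′(θ) → 0 as θ → 0⁺ and as θ → π⁻; (iii) μₙ → ∞ as n → ∞; and (iv) 1/l² < ωₙ²/μₙ ≤ E + (V_max − E)/2 for all n. -/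

import Mathlib

open Real MeasureTheory Set Filter Topology

/-- Δ₋(r) = (1+r²/l²)(r²+a²) − 2Mr -/
noncomputable def Dm (M l a r : ℝ) : ℝ := (1 + r^2/l^2)*(r^2+a^2) - 2*M*r

/-- V_σ(r) = Δ₋(r)/(r²+a²)² -/
noncomputable def Vsig (M l a r : ℝ) : ℝ := Dm M l a r / (r^2+a^2)^2

/-- Θ(α) = 1 if α>0, 0 if α≤0 -/
noncomputable def Th (α : ℝ) : ℝ := if 0 < α then 1 else 0

/-- V_junk -/
noncomputable def Vjunk (M l a α r : ℝ) : ℝ :=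
  -(3*r^2*(Dm M l a r)^2/(r^2+a^2)^4)
  + Dm M l a r * (5*r^4/l^2 + 3*r^2*(1+a^2/l^2) - 4*M*r + a^2)/(r^2+a^2)^3
  - (2/l^2) * (Dm M l a r * r^2/(r^2+a^2)^2)
  - (α/l^2) * (Dm M l a r /(r^2+a^2)^2) * Th α * a^2

/-- V_mass -/
noncomputable def Vmass (M l a α r : ℝ) : ℝ :=
  ((2-α)/l^2) * (Dm M l a r * r^2/(r^2+a^2)^2)

/-- The full potential in the tortoise coordinate, with semiclassical parameter h. -/
noncomputable def Vfull (M l a α : ℝ) (R : ℝ → ℝ) (h x : ℝ) : ℝ :=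
  Vsig M l a (R x) + h^2 * (Vjunk M l a α (R x) + Vmass M l a α (R x))

/-- κ is an eigenvalue of the Dirichlet problem P_DD(h). -/
def IsDirichletEigenvalue (M l a α : ℝ) (R : ℝ → ℝ) (xmax h κ : ℝ) : Prop :=
  ∃ u : ℝ → ℝ,
    (∃ x ∈ Set.Ico xmax (π/2), u x ≠ 0) ∧
    ContDiffOn ℝ 2 u (Set.Ico xmax (π/2)) ∧
    (∀ x ∈ Set.Ioo xmax (π/2),
      -h^2 * deriv (deriv u) x + Vfull M l a α R h x * u x = κ * u x) ∧
    u xmax = 0 ∧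
    MeasureTheory.IntegrableOn (fun x => (deriv u x)^2 + (R x)^2 * (u x)^2)
      (Set.Ioo xmax (π/2))



/-! ## A singular Sturm-Liouville initial value problem -/

noncomputable def clp (b t : ℝ) : ℝ := max 0 (min b t)

lemma clp_cont (b : ℝ) : Continuous (clp b) := by unfold clp; fun_prop

lemma clp_nonneg (b t : ℝ) : 0 ≤ clp b t := le_max_left _ _

lemma clp_le {b : ℝ} (hb : 0 ≤ b) (t : ℝ) : clp b t ≤ b := max_le hb (min_le_left _ _)

lemma clp_mem {b : ℝ} (hb : 0 ≤ b) (t : ℝ) : clp b t ∈ Icc 0 b := ⟨clp_nonneg _ _, clp_le hb t⟩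

lemma clp_eq {b t : ℝ} (h0 : 0 ≤ t) (h1 : t ≤ b) : clp b t = t := by
  unfold clp; rw [min_eq_right h1, max_eq_right h0]

noncomputable def Hop {P : Type*} (b β : ℝ) (f : ℝ → ℝ) (q : P → ℝ → ℝ) (g : P → ℝ → ℝ) (p : P) (t : ℝ) : ℝ :=
  (clp b t / f t) * ∫ σ in (0:ℝ)..1, σ ^ β * (q p (clp b t * σ) * g p (clp b t * σ))

noncomputable def Tit {P : Type*} (b β : ℝ) (f : ℝ → ℝ) (q : P → ℝ → ℝ) : ℕ → P → ℝ → ℝ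
  | 0 => fun _ _ => 1
  | n+1 => fun p t => ∫ s in (0:ℝ)..clp b t, Hop b β f q (Tit b β f q n) p s

lemma Hop_cont {P : Type*} [TopologicalSpace P] {b β : ℝ} (hβ : 0 ≤ β) {f : ℝ → ℝ} (hf : Continuous f)
    (hfp : ∀ t, 0 < f t) {q : P → ℝ → ℝ} (hq : Continuous (fun z : P × ℝ => q z.1 z.2))
    {g : P → ℝ → ℝ} (hg : Continuous (fun z : P × ℝ => g z.1 z.2)) :
    Continuous (fun z : P × ℝ => Hop b β f q g z.1 z.2) := by
  unfold Hop
  have hc := clp_cont b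
  refine Continuous.mul ?_ ?_
  · exact (hc.comp continuous_snd).div (hf.comp continuous_snd) (fun z => (hfp _).ne')
  · apply intervalIntegral.continuous_parametric_intervalIntegral_of_continuous (s := fun _ => 1) _ continuous_const
    have h1 : Continuous (fun w : (P × ℝ) × ℝ => clp b w.1.2 * w.2) := by fun_prop
    refine Continuous.mul ((Real.continuous_rpow_const hβ).comp continuous_snd) (Continuous.mul ?_ ?_)
    · exact hq.comp (g := fun z : P × ℝ => q z.1 z.2) (f := fun w : (P × ℝ) × ℝ => (w.1.1, clp b w.1.2 * w.2)) (by fun_prop)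
    · exact hg.comp (g := fun z : P × ℝ => g z.1 z.2) (f := fun w : (P × ℝ) × ℝ => (w.1.1, clp b w.1.2 * w.2)) (by fun_prop)

lemma intClp_cont {P : Type*} [TopologicalSpace P] {b : ℝ} 
    {g : P → ℝ → ℝ} (hg : Continuous (fun z : P × ℝ => g z.1 z.2)) :
    Continuous (fun z : P × ℝ => ∫ s in (0:ℝ)..clp b z.2, g z.1 s) := by
  have hc := clp_cont b
  apply intervalIntegral.continuous_parametric_intervalIntegral_of_continuous
  · exact hg.comp (g := fun z : P × ℝ => g z.1 z.2) (f := fun w : (P × ℝ) × ℝ => (w.1.1, w.2)) (by fun_prop)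
  · fun_prop

lemma Tit_cont {P : Type*} [TopologicalSpace P] {b β : ℝ} (hβ : 0 ≤ β) {f : ℝ → ℝ} (hf : Continuous f)
    (hfp : ∀ t, 0 < f t) {q : P → ℝ → ℝ} (hq : Continuous (fun z : P × ℝ => q z.1 z.2)) (n : ℕ) :
    Continuous (fun z : P × ℝ => Tit b β f q n z.1 z.2) := by
  induction n with
  | zero => simp only [Tit]; exact continuous_const
  | succ n ih => 
    simp only [Tit]
    exact intClp_cont (g := fun p s => Hop b β f q (Tit b β f q n) p s) (Hop_cont hβ hf hfp hq ih)

lemma rpow_le_one_aux {σ β : ℝ} (hβ : 0 ≤ β) (h0 : 0 ≤ σ) (h1 : σ ≤ 1) : |σ ^ β| ≤ 1 := by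
  rw [abs_of_nonneg (Real.rpow_nonneg h0 _)]; exact Real.rpow_le_one h0 h1 hβ

lemma Hop_bound {P : Type*} {b β F K m : ℝ} (hb : 0 ≤ b) (hβ : 0 ≤ β) {f : ℝ → ℝ}
    (hfp : ∀ t, 0 < f t) (hF : ∀ t, 1 / f t ≤ F) {q : P → ℝ → ℝ} {p : P} (hK : ∀ t, |q p t| ≤ K)
    {g : P → ℝ → ℝ} (t : ℝ) (hm : ∀ σ, 0 ≤ σ → σ ≤ clp b t → |g p σ| ≤ m) :
    |Hop b β f q g p t| ≤ b * F * K * m := by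
  have hK0 : 0 ≤ K := (abs_nonneg _).trans (hK 0)
  have hm0 : 0 ≤ m := (abs_nonneg _).trans (hm 0 le_rfl (clp_nonneg b t))
  have hF0 : 0 ≤ F := (one_div_pos.2 (hfp 0)).le.trans (hF 0)
  have h1 : |∫ σ in (0:ℝ)..1, σ ^ β * (q p (clp b t * σ) * g p (clp b t * σ))| ≤ (K * m) * |1 - 0| := by
    rw [← Real.norm_eq_abs]
    apply intervalIntegral.norm_integral_le_of_norm_le_const
    intro σ hσ
    rw [uIoc_of_le zero_le_one] at hσ
    rw [Real.norm_eq_abs, abs_mul, abs_mul]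
    have e1 := rpow_le_one_aux hβ hσ.1.le hσ.2
    have e2 := hK (clp b t * σ)
    have e3 := hm (clp b t * σ) (mul_nonneg (clp_nonneg b t) hσ.1.le)
      (mul_le_of_le_one_right (clp_nonneg b t) hσ.2)
    calc _ ≤ 1 * (K * m) := by gcongr
      _ = K * m := one_mul _
  unfold Hop
  rw [abs_mul]
  have h2 : |clp b t / f t| ≤ b * F := by
    rw [abs_of_nonneg (div_nonneg (clp_nonneg _ _) (hfp _).le), div_eq_mul_one_div]
    exact mul_le_mul (clp_le hb t) (hF t) (one_div_pos.2 (hfp t)).le hb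
  calc _ ≤ (b * F) * ((K * m) * |1 - 0|) := by gcongr
    _ = _ := by norm_num; ring

lemma Tit_bound {P : Type*} [TopologicalSpace P] {b β F K : ℝ} (hb : 0 ≤ b) (hβ : 0 ≤ β) {f : ℝ → ℝ}
    (hf : Continuous f)
    (hfp : ∀ t, 0 < f t) (hF : ∀ t, 1 / f t ≤ F) {q : P → ℝ → ℝ} 
    (hq : Continuous (fun z : P × ℝ => q z.1 z.2)) {p : P} (hK : ∀ t, |q p t| ≤ K)
    (n : ℕ) : ∀ t, |Tit b β f q n p t| ≤ (b * F * K * clp b t) ^ n / (n.factorial : ℝ) := by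
  have hK0 : 0 ≤ K := (abs_nonneg _).trans (hK 0)
  have hF0 : 0 ≤ F := (one_div_pos.2 (hfp 0)).le.trans (hF 0)
  set C := b * F * K with hC
  have hC0 : 0 ≤ C := by positivity
  induction n with
  | zero => intro t; simp [Tit]
  | succ n ih =>
    intro t
    have hc0 := clp_nonneg b t
    simp only [Tit]
    have key : ‖∫ s in (0:ℝ)..clp b t, Hop b β f q (Tit b β f q n) p s‖ ≤
        ∫ s in (0:ℝ)..clp b t, C * ((C * s) ^ n / (n.factorial : ℝ)) := by
      apply intervalIntegral.norm_integral_le_of_norm_le hc0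
      · refine Filter.Eventually.of_forall (fun s hs => ?_)
        rw [Real.norm_eq_abs]
        have hs1 : clp b s = s := clp_eq hs.1.le (hs.2.trans (clp_le hb t))
        apply Hop_bound hb hβ hfp hF hK
        intro σ h0 h1
        rw [hs1] at h1
        refine (ih σ).trans ?_
        rw [clp_eq h0 (h1.trans (hs.2.trans (clp_le hb t)))]
        gcongr
      · apply Continuous.intervalIntegrable; fun_prop
    refine key.trans (le_of_eq ?_)
    have e : ∀ s : ℝ, C * ((C * s) ^ n / (n.factorial : ℝ)) = (C ^ (n+1) / n.factorial) * s ^ n := by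
      intro s; rw [mul_pow]; ring
    simp only [e]
    clear_value C
    rw [intervalIntegral.integral_const_mul, integral_pow, Nat.factorial_succ, mul_pow C]
    have : (n.factorial : ℝ) ≠ 0 := by positivity
    push_cast
    field_simp
    simp

lemma Hop_Tit_bound {P : Type*} [TopologicalSpace P] {b β F K : ℝ} (hb : 0 ≤ b) (hβ : 0 ≤ β) {f : ℝ → ℝ}
    (hf : Continuous f)
    (hfp : ∀ t, 0 < f t) (hF : ∀ t, 1 / f t ≤ F) {q : P → ℝ → ℝ} 
    (hq : Continuous (fun z : P × ℝ => q z.1 z.2)) {p : P} (hK : ∀ t, |q p t| ≤ K)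
    (n : ℕ) (t : ℝ) : |Hop b β f q (Tit b β f q n) p t| ≤ b * F * K * ((b * F * K * b) ^ n / (n.factorial : ℝ)) := by
  have hK0 : 0 ≤ K := (abs_nonneg _).trans (hK 0)
  have hF0 : 0 ≤ F := (one_div_pos.2 (hfp 0)).le.trans (hF 0)
  apply Hop_bound hb hβ hfp hF hK
  intro σ _ _
  refine (Tit_bound hb hβ hf hfp hF hq hK n σ).trans ?_
  have := clp_nonneg b σ
  have := clp_le hb σ
  gcongr

lemma tsum_cont_aux {P : Type*} [TopologicalSpace P] {g : ℕ → P → ℝ → ℝ} {D : P → ℝ} {E : ℝ}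
    (hE : 0 ≤ E)
    (hD : Continuous D) (hD0 : ∀ p, 0 ≤ D p) (hg : ∀ n, Continuous (fun z : P × ℝ => g n z.1 z.2))
    (hb : ∀ n p t, |g n p t| ≤ (1 + D p) * ((D p * E) ^ n / (n.factorial : ℝ))) :
    Continuous (fun z : P × ℝ => ∑' n, g n z.1 z.2) := by
  rw [continuous_iff_continuousAt]
  intro z
  set U : Set (P × ℝ) := {y | D y.1 < D z.1 + 1} with hU
  have hUo : IsOpen U := isOpen_lt (hD.comp continuous_fst) continuous_const
  have hzU : z ∈ U := by simp [hU]
  have : ContinuousOn (fun z : P × ℝ => ∑' n, g n z.1 z.2) U := by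
    apply continuousOn_tsum (u := fun n => (1 + (D z.1 + 1)) * (((D z.1 + 1) * E) ^ n / (n.factorial : ℝ)))
    · intro n; exact (hg n).continuousOn
    · exact (Real.summable_pow_div_factorial _).mul_left _
    · intro n y hy
      refine (hb n y.1 y.2).trans ?_
      have h1 : D y.1 ≤ D z.1 + 1 := le_of_lt hy
      have h2 := hD0 y.1
      have h3 := hD0 z.1
      gcongr
  exact this.continuousAt (hUo.mem_nhds hzU)

/-- global version -/
lemma volterra_global {P : Type*} [TopologicalSpace P] {b β F : ℝ} (hb : 0 < b) (hβ : 0 ≤ β) {f : ℝ → ℝ}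
    (hf : Continuous f)
    (hfp : ∀ t, 0 < f t) (hF : ∀ t, 1 / f t ≤ F) {q : P → ℝ → ℝ} 
    (hq : Continuous (fun z : P × ℝ => q z.1 z.2)) {K : P → ℝ} (hKc : Continuous K) (hK : ∀ p t, |q p t| ≤ K p) :
    ∃ v h : P → ℝ → ℝ, Continuous (fun z : P × ℝ => v z.1 z.2) ∧ Continuous (fun z : P × ℝ => h z.1 z.2) ∧
      (∀ p t, v p t = 1 + ∫ s in (0:ℝ)..clp b t, h p s) ∧
      (∀ p t, h p t = Hop b β f q v p t) := by
  have hF0 : 0 ≤ F := (one_div_pos.2 (hfp 0)).le.trans (hF 0)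
  have hK0 : ∀ p, 0 ≤ K p := fun p => (abs_nonneg _).trans (hK p 0)
  set g := Tit b β f q with hg
  have gc := fun n => Tit_cont (b := b) hβ hf hfp hq n
  have gB : ∀ n p t, |g n p t| ≤ (b * F * K p * b) ^ n / (n.factorial : ℝ) := by
    intro n p t
    refine (Tit_bound hb.le hβ hf hfp hF hq (hK p) n t).trans ?_
    have := clp_nonneg b t
    have := clp_le hb.le t
    have := hK0 p
    gcongr
  have HB := fun n p t => Hop_Tit_bound hb.le hβ hf hfp hF hq (hK p) n t
  have Hc := fun n => Hop_cont (b := b) hβ hf hfp hq (gc n)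
  have gS : ∀ p t, Summable (fun n => g n p t) := fun p t =>
    Summable.of_norm_bounded (Real.summable_pow_div_factorial (b * F * K p * b)) (fun n => gB n p t)
  have HS : ∀ p t, Summable (fun n => Hop b β f q (g n) p t) := fun p t =>
    Summable.of_norm_bounded ((Real.summable_pow_div_factorial (b * F * K p * b)).mul_left (b * F * K p))
      (fun n => HB n p t)
  have hDc : Continuous (fun p => b * F * K p) := by fun_prop
  have hD0 : ∀ p, 0 ≤ b * F * K p := fun p => by have := hK0 p; positivity
  refine ⟨fun p t => ∑' n, g n p t, fun p t => ∑' n, Hop b β f q (g n) p t, ?_, ?_, ?_, ?_⟩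
  · apply tsum_cont_aux (D := fun p => b * F * K p) (E := b) hb.le hDc hD0 gc
    intro n p t
    refine (gB n p t).trans ?_
    have := hD0 p
    have h2 : 0 ≤ (b * F * K p * b) ^ n / (n.factorial : ℝ) := by positivity
    nlinarith
  · apply tsum_cont_aux (D := fun p => b * F * K p) (E := b) hb.le hDc hD0 Hc
    intro n p t
    refine (HB n p t).trans ?_
    have := hD0 p
    have h2 : 0 ≤ (b * F * K p * b) ^ n / (n.factorial : ℝ) := by positivity
    nlinarith
  · intro p t
    have key : HasSum (fun n => ∫ s in (0:ℝ)..clp b t, Hop b β f q (g n) p s)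
        (∫ s in (0:ℝ)..clp b t, ∑' n, Hop b β f q (g n) p s) := by
      apply intervalIntegral.hasSum_integral_of_dominated_convergence
        (fun n _ => b * F * K p * ((b * F * K p * b) ^ n / (n.factorial : ℝ)))
      · intro n
        exact ((Hc n).comp (Continuous.prodMk_right p)).aestronglyMeasurable
      · intro n
        exact Filter.Eventually.of_forall (fun s _ => HB n p s)
      · exact Filter.Eventually.of_forall (fun s _ => 
          (Real.summable_pow_div_factorial (b * F * K p * b)).mul_left (b * F * K p))
      · exact intervalIntegrable_const
      · exact Filter.Eventually.of_forall (fun s _ => (HS p s).hasSum)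
    rw [← key.tsum_eq]
    show ∑' n, g n p t = _
    rw [(gS p t).tsum_eq_zero_add]
    rfl
  · intro p t
    have key : HasSum (fun n => ∫ σ in (0:ℝ)..1, σ ^ β * (q p (clp b t * σ) * g n p (clp b t * σ)))
        (∫ σ in (0:ℝ)..1, σ ^ β * (q p (clp b t * σ) * ∑' n, g n p (clp b t * σ))) := by
      apply intervalIntegral.hasSum_integral_of_dominated_convergence
        (fun n _ => K p * ((b * F * K p * b) ^ n / (n.factorial : ℝ)))
      · intro n
        apply Continuous.aestronglyMeasurable
        refine Continuous.mul (Real.continuous_rpow_const hβ) (Continuous.mul ?_ ?_)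
        · exact hq.comp (g := fun z : P × ℝ => q z.1 z.2) (f := fun w : ℝ => (p, clp b t * w)) (by fun_prop)
        · exact (gc n).comp (g := fun z : P × ℝ => g n z.1 z.2) (f := fun w : ℝ => (p, clp b t * w)) (by fun_prop)
      · intro n
        refine Filter.Eventually.of_forall (fun σ hσ => ?_)
        rw [uIoc_of_le zero_le_one] at hσ
        rw [Real.norm_eq_abs, abs_mul, abs_mul]
        have e1 := rpow_le_one_aux hβ hσ.1.le hσ.2
        have e2 := hK p (clp b t * σ)
        have e3 := gB n p (clp b t * σ)
        have := hK0 p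
        calc _ ≤ 1 * (K p * ((b * F * K p * b) ^ n / (n.factorial : ℝ))) := by gcongr
          _ = _ := one_mul _
      · exact Filter.Eventually.of_forall (fun s _ => 
          (Real.summable_pow_div_factorial (b * F * K p * b)).mul_left (K p))
      · exact intervalIntegrable_const
      · exact Filter.Eventually.of_forall (fun s _ => ((gS p _).hasSum.mul_left _).mul_left _)
    have k2 := key.mul_left (clp b t / f t)
    exact k2.tsum_eq

/-- Local version of the Volterra construction. -/
lemma volterra {P : Type*} [TopologicalSpace P] {b β : ℝ} (hb : 0 < b) (hβ : 0 ≤ β) {f : ℝ → ℝ}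
    (hf : ContinuousOn f (Icc 0 b))
    (hfp : ∀ t ∈ Icc 0 b, 0 < f t) {q : P → ℝ → ℝ} 
    (hq : ContinuousOn (fun z : P × ℝ => q z.1 z.2) (univ ×ˢ Icc 0 b)) :
    ∃ v h : P → ℝ → ℝ, Continuous (fun z : P × ℝ => v z.1 z.2) ∧ Continuous (fun z : P × ℝ => h z.1 z.2) ∧
      (∀ p, v p 0 = 1) ∧ (∀ p, h p 0 = 0) ∧
      (∀ p, ∀ t ∈ Ioo 0 b, HasDerivAt (v p) (h p t) t) ∧
      (∀ p, ∀ t ∈ Ioo 0 b, HasDerivAt (fun t => t ^ β * f t * h p t) (t ^ β * q p t * v p t) t) := by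
  have hc := clp_cont b
  have hcm := clp_mem hb.le
  set f' : ℝ → ℝ := fun t => f (clp b t) with hf'
  set q' : P → ℝ → ℝ := fun p t => q p (clp b t) with hq'
  have cf' : Continuous f' := hf.comp_continuous hc hcm
  have cq' : Continuous (fun z : P × ℝ => q' z.1 z.2) := 
    hq.comp_continuous (f := fun z : P × ℝ => (z.1, clp b z.2)) (by fun_prop) (fun z => ⟨mem_univ _, hcm _⟩)
  have pf' : ∀ t, 0 < f' t := fun t => hfp _ (hcm t)
  obtain ⟨F, hF⟩ : ∃ F, ∀ t, 1 / f' t ≤ F := by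
    obtain ⟨x, hx, hmin⟩ := isCompact_Icc.exists_isMinOn (nonempty_Icc.2 hb.le) hf
    refine ⟨1 / f x, fun t => one_div_le_one_div_of_le (hfp x hx) (hmin (hcm t))⟩
  set K : P → ℝ := fun p => sSup ((fun t => |q' p t|) '' Icc 0 b) with hKdef
  have hKc : Continuous K := isCompact_Icc.continuous_sSup (f := fun p t => |q' p t|) (by
    exact cq'.abs)
  have hK : ∀ p t, |q' p t| ≤ K p := by
    intro p t
    have hcc : ContinuousOn (fun t => |q' p t|) (Icc 0 b) := 
      ((cq'.comp (Continuous.prodMk_right p)).abs).continuousOn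
    apply le_csSup (isCompact_Icc.bddAbove_image hcc)
    refine ⟨clp b t, hcm t, ?_⟩
    simp only [hq']
    rw [clp_eq (hcm t).1 (hcm t).2]
  obtain ⟨v, h, cv, ch, ev, eh⟩ := volterra_global hb hβ cf' pf' hF cq' hKc hK
  refine ⟨v, h, cv, ch, ?_, ?_, ?_, ?_⟩
  · intro p; rw [ev, clp_eq le_rfl hb.le]; simp
  · intro p; rw [eh]; unfold Hop; rw [clp_eq le_rfl hb.le]; simp
  · intro p t ht
    have chp : Continuous (h p) := ch.comp (Continuous.prodMk_right p)
    have e : v p =ᶠ[𝓝 t] fun t => 1 + ∫ s in (0:ℝ)..t, h p s := by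
      filter_upwards [isOpen_Ioo.mem_nhds ht] with x hx
      rw [ev, clp_eq hx.1.le hx.2.le]
    refine HasDerivAt.congr_of_eventuallyEq ?_ e
    refine HasDerivAt.const_add 1 ?_
    exact intervalIntegral.integral_hasDerivAt_right (chp.intervalIntegrable _ _)
      (chp.stronglyMeasurableAtFilter _ _) chp.continuousAt
  · intro p t ht
    have cvp : Continuous (v p) := cv.comp (Continuous.prodMk_right p)
    have cqp : Continuous (q' p) := cq'.comp (Continuous.prodMk_right p)
    have cG : Continuous (fun s => s ^ β * (q' p s * v p s)) := 
      (Real.continuous_rpow_const hβ).mul (cqp.mul cvp)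
    have e : (fun t => t ^ β * f t * h p t) =ᶠ[𝓝 t] fun t => ∫ s in (0:ℝ)..t, s ^ β * (q' p s * v p s) := by
      filter_upwards [isOpen_Ioo.mem_nhds ht] with x hx
      have hx0 : 0 < x := hx.1
      rw [eh]; unfold Hop
      have ecl : clp b x = x := clp_eq hx.1.le hx.2.le
      have hfx : f' x = f x := by simp only [hf', ecl]
      rw [ecl, hfx]
      have hfx0 : f x ≠ 0 := (hfp x ⟨hx.1.le, hx.2.le⟩).ne'
      have e1 : ∫ s in (0:ℝ)..x, s ^ β * (q' p s * v p s) = 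
          x * ∫ σ in (0:ℝ)..1, (x * σ) ^ β * (q' p (x * σ) * v p (x * σ)) := by
        have := intervalIntegral.integral_comp_mul_left (a := 0) (b := 1) (c := x)
          (fun s => s ^ β * (q' p s * v p s)) hx0.ne'
        rw [this]; simp [hx0.ne']
      have e2 : ∫ σ in (0:ℝ)..1, (x * σ) ^ β * (q' p (x * σ) * v p (x * σ)) = 
          x ^ β * ∫ σ in (0:ℝ)..1, σ ^ β * (q' p (x * σ) * v p (x * σ)) := by
        rw [← intervalIntegral.integral_const_mul]
        apply intervalIntegral.integral_congr
        intro σ hσ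
        rw [uIcc_of_le zero_le_one] at hσ
        simp only
        rw [Real.mul_rpow hx0.le hσ.1]; ring
      rw [e1, e2]
      field_simp
    refine HasDerivAt.congr_of_eventuallyEq ?_ e
    have e3 : t ^ β * q p t * v p t = t ^ β * (q' p t * v p t) := by
      simp only [hq', clp_eq ht.1.le ht.2.le]; ring
    rw [e3]
    exact intervalIntegral.integral_hasDerivAt_right (cG.intervalIntegrable _ _)
      (cG.stronglyMeasurableAtFilter _ _) cG.continuousAt

/-! ## Qualitative properties of solutions -/

/-- Solutions of the singular Sturm-Liouville equation normalised to be one at the origin. -/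
structure SLSol (b β : ℝ) (f q v h : ℝ → ℝ) : Prop where
  hb : 0 < b
  hβ : 0 ≤ β
  fc : ContinuousOn f (Icc 0 b)
  fp : ∀ t ∈ Icc 0 b, 0 < f t
  qc : ContinuousOn q (Icc 0 b)
  vc : Continuous v
  hc : Continuous h
  v0 : v 0 = 1
  h0 : h 0 = 0
  dv : ∀ t ∈ Ioo 0 b, HasDerivAt v (h t) t
  dw : ∀ t ∈ Ioo 0 b, HasDerivAt (fun t => t ^ β * f t * h t) (t ^ β * q t * v t) t

lemma linear_unique {a b c : ℝ} {A B X Z : ℝ → ℝ} (hA : ContinuousOn A (Ioo a b)) (hB : ContinuousOn B (Ioo a b))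
    (hX : ∀ t ∈ Ioo a b, HasDerivAt X (A t * Z t) t) (hZ : ∀ t ∈ Ioo a b, HasDerivAt Z (B t * X t) t)
    (hc : c ∈ Ioo a b) (hXc : X c = 0) (hZc : Z c = 0) : ∀ t ∈ Ioo a b, X t = 0 ∧ Z t = 0 := by
  intro t ht
  obtain ⟨a', ha1, ha2⟩ := exists_between (lt_min hc.1 ht.1)
  obtain ⟨b', hb1, hb2⟩ := exists_between (max_lt hc.2 ht.2)
  have ha3 := ha2.trans_le (min_le_left _ _)
  have ha4 := ha2.trans_le (min_le_right _ _)
  have hb3 := (le_max_left _ _).trans_lt hb1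
  have hb4 := (le_max_right _ _).trans_lt hb1
  have hsub : Icc a' b' ⊆ Ioo a b := fun x hx => ⟨ha1.trans_le hx.1, hx.2.trans_lt hb2⟩
  obtain ⟨KA, hKA⟩ := isCompact_Icc.exists_bound_of_continuousOn (hA.mono hsub)
  obtain ⟨KB, hKB⟩ := isCompact_Icc.exists_bound_of_continuousOn (hB.mono hsub)
  set K : NNReal := ⟨max 0 (max KA KB), le_max_left _ _⟩ with hK
  have hKA' : KA ≤ K := (le_max_left _ _).trans (le_max_right _ _)
  have hKB' : KB ≤ K := (le_max_right _ _).trans (le_max_right _ _)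
  have key := ODE_solution_unique_of_mem_Ioo (E := ℝ × ℝ) (v := fun t z => (A t * z.2, B t * z.1))
    (s := fun _ => univ) (K := K) (f := fun t => (X t, Z t)) (g := fun _ => (0, 0)) (a := a') (b := b') (t₀ := c)
    (by
      intro t ht
      apply LipschitzWith.lipschitzOnWith
      apply LipschitzWith.of_dist_le_mul
      intro x y
      have h1 := (hKA t (Ioo_subset_Icc_self ht)).trans hKA'
      have h2 := (hKB t (Ioo_subset_Icc_self ht)).trans hKB'
      rw [Prod.dist_eq, Prod.dist_eq]
      simp only [Real.dist_eq, ← mul_sub, abs_mul]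
      rw [Real.norm_eq_abs] at h1 h2
      have h3 : (0:ℝ) ≤ K := K.2
      apply max_le
      · exact mul_le_mul h1 (le_max_right _ _) (abs_nonneg _) h3
      · exact mul_le_mul h2 (le_max_left _ _) (abs_nonneg _) h3)
    ⟨ha3, hb3⟩
    (fun t ht => ⟨(hX t (hsub (Ioo_subset_Icc_self ht))).prodMk (hZ t (hsub (Ioo_subset_Icc_self ht))), mem_univ _⟩)
    (fun t ht => ⟨by
      have := hasDerivAt_const t ((0:ℝ),(0:ℝ))
      simp only [mul_zero]
      exact this, mem_univ _⟩)
    (by simp [hXc, hZc])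
  have := key ⟨ha4, hb4⟩
  simpa using this

namespace SLSol
variable {b β : ℝ} {f q v h : ℝ → ℝ}

lemma pc (S : SLSol b β f q v h) : ContinuousOn (fun t => t ^ β * f t) (Icc 0 b) :=
  (Real.continuous_rpow_const S.hβ).continuousOn.mul S.fc

lemma wc (S : SLSol b β f q v h) : ContinuousOn (fun t => t ^ β * f t * h t) (Icc 0 b) :=
  S.pc.mul S.hc.continuousOn

lemma pp (S : SLSol b β f q v h) {t : ℝ} (ht : t ∈ Ioc 0 b) : 0 < t ^ β * f t :=
  mul_pos (Real.rpow_pos_of_pos ht.1 _) (S.fp t ⟨ht.1.le, ht.2⟩)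

lemma no_double_zero (S : SLSol b β f q v h) {c : ℝ} (hc : c ∈ Ioo 0 b) (h1 : v c = 0) (h2 : h c = 0) : False := by
  have hsub : Ioo 0 b ⊆ Icc 0 b := Ioo_subset_Icc_self
  have key := linear_unique (A := fun t => 1 / (t ^ β * f t)) (B := fun t => t ^ β * q t) (X := v)
    (Z := fun t => t ^ β * f t * h t) (a := 0) (b := b) (c := c)
    (continuousOn_const.div (S.pc.mono hsub) (fun t ht => (S.pp ⟨ht.1, ht.2.le⟩).ne'))
    (((Real.continuous_rpow_const S.hβ).continuousOn.mul S.qc).mono hsub)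
    (fun t ht => by
      have := S.dv t ht
      have hp := (S.pp ⟨ht.1, ht.2.le⟩).ne'
      convert this using 1
      rw [one_div, inv_mul_cancel_left₀ hp])
    S.dw hc h1 (by simp [h2])
  have hcl : closure (Ioo 0 b) ⊆ {t | v t = 0} := by
    apply closure_minimal
    · intro t ht; exact (key t ht).1
    · exact isClosed_eq S.vc continuous_const
  rw [closure_Ioo S.hb.ne] at hcl
  have := hcl ⟨le_rfl, S.hb.le⟩
  simp [S.v0] at this

lemma deriv_w (S : SLSol b β f q v h) {t : ℝ} (ht : t ∈ Ioo 0 b) :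
    deriv (fun t => t ^ β * f t * h t) t = t ^ β * q t * v t := (S.dw t ht).deriv

/-- A nonnegative solution can vanish only at the end point. -/
lemma zero_end (S : SLSol b β f q v h) {r c : ℝ} (hr : r < b) (hn : ∀ t ∈ Icc 0 r, 0 ≤ v t)
    (hc : c ∈ Icc 0 r) (h1 : v c = 0) : c = r := by
  by_contra hne
  have hc0 : 0 < c := by
    rcases hc.1.lt_or_eq with h | h
    · exact h
    · rw [← h, S.v0] at h1; norm_num at h1
  have hcr : c < r := lt_of_le_of_ne hc.2 hne
  have hm : IsLocalMin v c := by
    filter_upwards [isOpen_Ioo.mem_nhds (show c ∈ Ioo 0 r from ⟨hc0, hcr⟩)] with t ht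
    rw [h1]; exact hn t ⟨ht.1.le, ht.2.le⟩
  have hcb : c ∈ Ioo 0 b := ⟨hc0, hcr.trans hr⟩
  exact S.no_double_zero hcb h1 (hm.hasDerivAt_eq_zero (S.dv c hcb))

lemma first_zero {v : ℝ → ℝ} (hv : Continuous v) (h0 : 0 < v 0) {r : ℝ}
    (hex : ∃ t ∈ Icc 0 r, v t ≤ 0) : ∃ z ∈ Ioc 0 r, v z = 0 ∧ ∀ t ∈ Ico 0 z, 0 < v t := by
  set s : Set ℝ := Icc 0 r ∩ {t | v t ≤ 0} with hs
  have hcomp : IsCompact s := isCompact_Icc.inter_right (isClosed_le hv continuous_const)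
  obtain ⟨t, ht, htv⟩ := hex
  obtain ⟨z, hz, hzl⟩ := hcomp.exists_isLeast ⟨t, ht, htv⟩
  have hz0 : 0 < z := by
    rcases hz.1.1.lt_or_eq with h | h
    · exact h
    · have := hz.2; rw [← h] at this; exact absurd this (not_le.2 h0)
  have hpos : ∀ t ∈ Ico 0 z, 0 < v t := by
    intro t ht
    by_contra hcon
    have := hzl ⟨⟨ht.1, ht.2.le.trans hz.1.2⟩, not_lt.1 hcon⟩
    linarith [ht.2]
  refine ⟨z, ⟨hz0, hz.1.2⟩, le_antisymm hz.2 ?_, hpos⟩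
  have hcl : closure (Ico 0 z) ⊆ {t | 0 ≤ v t} :=
    closure_minimal (fun t ht => (hpos t ht).le) (isClosed_le continuous_const hv)
  rw [closure_Ico hz0.ne] at hcl
  exact hcl ⟨hz0.le, le_rfl⟩

lemma pos_of_bound (S : SLSol b β f q v h) {r C : ℝ} (hr : r < b) (hC : 0 ≤ C)
    (hq : ∀ t ∈ Ioo 0 r, 0 ≤ q t + C * (β + 1) - C ^ 2 * t ^ 2 / f t) : ∀ t ∈ Icc 0 r, 0 < v t := by
  by_contra hcon
  push Not at hcon
  obtain ⟨z, hz, hvz, hpos⟩ := first_zero S.vc (by rw [S.v0]; norm_num) hcon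
  have hb := S.hb
  -- integrating factor
  have ccl := clp_cont b
  have ck : Continuous (fun s => clp b s / f (clp b s)) :=
    ccl.div (S.fc.comp_continuous ccl (clp_mem hb.le)) (fun s => (S.fp _ (clp_mem hb.le s)).ne')
  set g : ℝ → ℝ := fun t => Real.exp (-(C * ∫ s in (0:ℝ)..t, clp b s / f (clp b s))) with hg
  have dg : ∀ t ∈ Ioo 0 b, HasDerivAt g (g t * (-(C * (t / f t)))) t := by
    intro t ht
    have h1 : HasDerivAt (fun t => ∫ s in (0:ℝ)..t, clp b s / f (clp b s)) (clp b t / f (clp b t)) t :=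
      intervalIntegral.integral_hasDerivAt_right (ck.intervalIntegrable _ _)
        (ck.stronglyMeasurableAtFilter _ _) ck.continuousAt
    rw [clp_eq ht.1.le ht.2.le] at h1
    exact ((h1.const_mul C).neg).exp
  have gpos : ∀ t, 0 < g t := fun t => Real.exp_pos _
  have gc : Continuous g := by
    have : Continuous (fun t => ∫ s in (0:ℝ)..t, clp b s / f (clp b s)) :=
      intervalIntegral.continuous_primitive (fun a b => ck.intervalIntegrable a b) 0
    simp only [hg]; fun_prop
  have hzb : z < b := hz.2.trans_lt hr
  have hsub : Icc 0 z ⊆ Icc 0 b := Icc_subset_Icc_right hzb.le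
  have crp : ContinuousOn (fun t : ℝ => t ^ (β + 1)) (Icc 0 z) :=
    (Real.continuous_rpow_const (by linarith [S.hβ])).continuousOn
  -- N = w + C t^(β+1) v
  have mono1 : MonotoneOn (fun t => g t * (t ^ β * f t * h t + C * t ^ (β + 1) * v t)) (Icc 0 z) := by
    have dd : ∀ t ∈ Ioo 0 z, HasDerivAt (fun t => g t * (t ^ β * f t * h t + C * t ^ (β + 1) * v t))
        (g t * (t ^ β * (q t + C * (β + 1) - C ^ 2 * t ^ 2 / f t) * v t)) t := by
      intro t ht
      have htb : t ∈ Ioo 0 b := ⟨ht.1, ht.2.trans hzb⟩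
      have d1 : HasDerivAt (fun t : ℝ => C * t ^ (β + 1)) (C * ((β + 1) * t ^ β)) t := by
        have := (Real.hasDerivAt_rpow_const (x := t) (p := β + 1) (Or.inl ht.1.ne')).const_mul C
        simpa using this
      have d2 := (dg t htb).mul ((S.dw t htb).add (d1.mul (S.dv t htb)))
      refine d2.congr_deriv ?_
      have hf0 := (S.fp t ⟨htb.1.le, htb.2.le⟩).ne'
      simp only [Pi.add_apply, Pi.mul_apply]
      rw [Real.rpow_add_one ht.1.ne']
      field_simp
      ring
    apply monotoneOn_of_deriv_nonneg (convex_Icc _ _)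
    · exact gc.continuousOn.mul ((S.wc.mono hsub).add ((continuousOn_const.mul crp).mul S.vc.continuousOn))
    · rw [interior_Icc]
      exact fun t ht => (dd t ht).differentiableAt.differentiableWithinAt
    · rw [interior_Icc]
      intro t ht
      rw [(dd t ht).deriv]
      have e1 := hq t ⟨ht.1, ht.2.trans_le hz.2⟩
      have e2 := hpos t ⟨ht.1.le, ht.2⟩
      have e3 := gpos t
      have e4 := Real.rpow_pos_of_pos ht.1 β
      positivity
  have Nn : ∀ t ∈ Icc 0 z, 0 ≤ t ^ β * f t * h t + C * t ^ (β + 1) * v t := by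
    intro t ht
    have := mono1 (left_mem_Icc.2 hz.1.le) ht ht.1
    simp only [S.h0, Real.zero_rpow (show β + 1 ≠ 0 by linarith [S.hβ]), mul_zero, zero_mul, add_zero] at this
    exact nonneg_of_mul_nonneg_right this (gpos t)
  have mono2 : MonotoneOn (fun t => v t / g t) (Icc 0 z) := by
    have dd : ∀ t ∈ Ioo 0 z, HasDerivAt (fun t => v t / g t) ((h t + C * (t / f t) * v t) / g t) t := by
      intro t ht
      have htb : t ∈ Ioo 0 b := ⟨ht.1, ht.2.trans hzb⟩
      refine ((S.dv t htb).div (dg t htb) (gpos t).ne').congr_deriv ?_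
      have := (gpos t).ne'
      field_simp
      ring
    apply monotoneOn_of_deriv_nonneg (convex_Icc _ _)
    · exact S.vc.continuousOn.div gc.continuousOn (fun t _ => (gpos t).ne')
    · rw [interior_Icc]
      exact fun t ht => (dd t ht).differentiableAt.differentiableWithinAt
    · rw [interior_Icc]
      intro t ht
      rw [(dd t ht).deriv]
      have htb : t ∈ Ioc 0 b := ⟨ht.1, (ht.2.trans hzb).le⟩
      have e1 := Nn t ⟨ht.1.le, ht.2.le⟩
      have hp := S.pp htb
      have hf0 := (S.fp t ⟨htb.1.le, htb.2⟩)
      have e2 : h t + C * (t / f t) * v t = (t ^ β * f t * h t + C * t ^ (β + 1) * v t) / (t ^ β * f t) := by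
        have := (Real.rpow_pos_of_pos ht.1 β).ne'
        rw [Real.rpow_add_one ht.1.ne']
        field_simp
      rw [e2]
      exact div_nonneg (div_nonneg e1 hp.le) (gpos t).le
  have := mono2 (left_mem_Icc.2 hz.1.le) (right_mem_Icc.2 hz.1.le) hz.1.le
  simp only [hvz, S.v0, zero_div] at this
  exact absurd this (not_le.2 (one_div_pos.2 (gpos 0)))

lemma exists_nonpos {b β r : ℝ} {f : ℝ → ℝ} (hβ : 0 ≤ β) (fc : ContinuousOn f (Icc 0 b)) (hr0 : 0 < r) (hr : r < b) :
    ∃ L : ℝ, ∀ q v h, SLSol b β f q v h → (∀ t ∈ Ioo 0 r, q t ≤ -L) → ∃ t ∈ Icc 0 r, v t ≤ 0 := by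
  have hpc : ContinuousOn (fun t => t ^ β * f t) (Icc 0 b) :=
    (Real.continuous_rpow_const hβ).continuousOn.mul fc
  obtain ⟨P0, hP0⟩ := isCompact_Icc.exists_bound_of_continuousOn hpc
  set P := max 1 P0 with hP
  have hPpos : 0 < P := lt_of_lt_of_le one_pos (le_max_left _ _)
  set e := (r / 3) ^ β with he
  have hepos : 0 < e := Real.rpow_pos_of_pos (by positivity) _
  refine ⟨9 * P / (e * r ^ 2), fun q v h S hq => ?_⟩
  set L := 9 * P / (e * r ^ 2) with hL
  have hLpos : 0 < L := by positivity
  by_contra hcon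
  push Not at hcon
  have hsub : Icc 0 r ⊆ Icc 0 b := Icc_subset_Icc_right hr.le
  have hioo : ∀ t ∈ Ioo 0 r, t ∈ Ioo 0 b := fun t ht => ⟨ht.1, ht.2.trans hr⟩
  have wanti : AntitoneOn (fun t => t ^ β * f t * h t) (Icc 0 r) := by
    apply antitoneOn_of_deriv_nonpos (convex_Icc _ _) (S.wc.mono hsub)
    · rw [interior_Icc]
      exact fun t ht => (S.dw t (hioo t ht)).differentiableAt.differentiableWithinAt
    · rw [interior_Icc]
      intro t ht
      rw [S.deriv_w (hioo t ht)]
      have e1 := hq t ht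
      have e2 := hcon t ⟨ht.1.le, ht.2.le⟩
      have e4 := Real.rpow_pos_of_pos ht.1 β
      have : 0 ≤ t ^ β * (-q t) * v t := by
        have : 0 ≤ -q t := by linarith
        positivity
      linarith
  have wneg : ∀ t ∈ Icc 0 r, t ^ β * f t * h t ≤ 0 := by
    intro t ht
    have := wanti (left_mem_Icc.2 hr0.le) ht ht.1
    simpa [S.h0] using this
  have hneg : ∀ t ∈ Ioo 0 r, h t ≤ 0 := by
    intro t ht
    have hp := S.pp (t := t) ⟨ht.1, (ht.2.trans hr).le⟩
    have := wneg t ⟨ht.1.le, ht.2.le⟩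
    by_contra hh
    have := mul_pos hp (not_le.1 hh)
    linarith
  have vanti : AntitoneOn v (Icc 0 r) := by
    apply antitoneOn_of_deriv_nonpos (convex_Icc _ _) S.vc.continuousOn
    · rw [interior_Icc]
      exact fun t ht => (S.dv t (hioo t ht)).differentiableAt.differentiableWithinAt
    · rw [interior_Icc]
      intro t ht
      rw [(S.dv t (hioo t ht)).deriv]
      exact hneg t ht
  set m := 2 * r / 3 with hm
  set k := r / 3 with hk
  have hk0 : 0 < k := by positivity
  have hkm : k ≤ m := by simp only [hk, hm]; linarith
  have hmr : m ≤ r := by simp only [hm]; linarith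
  have hvm := hcon m ⟨hk0.le.trans hkm, hmr⟩
  have step1 : m ^ β * f m * h m - k ^ β * f k * h k ≤ (-(L * e * v m)) * (m - k) := by
    apply (convex_Icc k m).image_sub_le_mul_sub_of_deriv_le (f := fun t => t ^ β * f t * h t)
    · exact S.wc.mono (fun t ht => ⟨hk0.le.trans ht.1, ht.2.trans (hmr.trans hr.le)⟩)
    · rw [interior_Icc]
      exact fun t ht => (S.dw t ⟨hk0.trans ht.1, ht.2.trans (hmr.trans_lt hr)⟩).differentiableAt.differentiableWithinAt
    · rw [interior_Icc]
      intro t ht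
      have htr : t ∈ Ioo 0 r := ⟨hk0.trans ht.1, ht.2.trans_le hmr⟩
      rw [S.deriv_w (hioo t htr)]
      have e1 := hq t htr
      have e2 : v m ≤ v t := vanti ⟨htr.1.le, htr.2.le⟩ ⟨hk0.le.trans hkm, hmr⟩ ht.2.le
      have e3 : e ≤ t ^ β := Real.rpow_le_rpow hk0.le ht.1.le hβ
      have e5 : L * e * v m ≤ (-q t) * t ^ β * v t := by
        have : L ≤ -q t := by linarith
        have : 0 ≤ -q t := hLpos.le.trans this
        have : 0 ≤ -q t * t ^ β := mul_nonneg this (Real.rpow_nonneg htr.1.le _)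
        gcongr
      linarith
    · exact left_mem_Icc.2 hkm
    · exact right_mem_Icc.2 hkm
    · exact hkm
  have hwk := wneg k ⟨hk0.le, hkm.trans hmr⟩
  have hmk : m - k = r / 3 := by simp only [hm, hk]; ring
  rw [hmk] at step1
  have step2 : v r - v m ≤ (-(L * e * v m * (r / 3) / P)) * (r - m) := by
    apply (convex_Icc m r).image_sub_le_mul_sub_of_deriv_le (f := v)
    · exact S.vc.continuousOn
    · rw [interior_Icc]
      exact fun t ht => (S.dv t ⟨(hk0.trans_le hkm).trans ht.1, ht.2.trans hr⟩).differentiableAt.differentiableWithinAt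
    · rw [interior_Icc]
      intro t ht
      have htr : t ∈ Ioo 0 r := ⟨(hk0.trans_le hkm).trans ht.1, ht.2⟩
      rw [(S.dv t (hioo t htr)).deriv]
      have e1 : t ^ β * f t * h t ≤ m ^ β * f m * h m :=
        wanti ⟨hk0.le.trans hkm, hmr⟩ ⟨htr.1.le, htr.2.le⟩ ht.1.le
      have e2 : t ^ β * f t * h t ≤ -(L * e * v m * (r / 3)) := by linarith
      have hp := S.pp (t := t) ⟨htr.1, (htr.2.trans hr).le⟩
      have hpP : t ^ β * f t ≤ P := by
        have := hP0 t ⟨htr.1.le, (htr.2.trans hr).le⟩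
        rw [Real.norm_eq_abs] at this
        exact (le_abs_self _).trans (this.trans (le_max_right _ _))
      have e3 : 0 < L * e * v m * (r / 3) := by positivity
      rw [← neg_div, le_div_iff₀ hPpos]
      nlinarith [hneg t htr]
    · exact left_mem_Icc.2 hmr
    · exact right_mem_Icc.2 hmr
    · exact hmr
  have hvr := hcon r ⟨hr0.le, le_rfl⟩
  have hrm : r - m = r / 3 := by simp only [hm]; ring
  rw [hrm] at step2
  have e6 : (-(L * e * v m * (r / 3) / P)) * (r / 3) = - v m := by
    simp only [hL]; field_simp; norm_num
  linarith

lemma ground_unique {q₂ v₂ h₂ : ℝ → ℝ} (S : SLSol b β f q v h) (S₂ : SLSol b β f q₂ v₂ h₂) {r : ℝ} (hr0 : 0 < r) (hr : r < b)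
    (hq : ∀ t ∈ Ioo 0 r, q₂ t < q t) (h1 : ∀ t ∈ Ioo 0 r, 0 < v t) (h2 : ∀ t ∈ Ioo 0 r, 0 < v₂ t)
    (e1 : v r = 0) (e2 : v₂ r = 0) : False := by
  have hsub : Icc 0 r ⊆ Icc 0 b := Icc_subset_Icc_right hr.le
  have mono : StrictMonoOn (fun t => (t ^ β * f t * h t) * v₂ t - (t ^ β * f t * h₂ t) * v t) (Icc 0 r) := by
    apply strictMonoOn_of_deriv_pos (convex_Icc _ _)
    · exact ((S.wc.mono hsub).mul S₂.vc.continuousOn).sub ((S₂.wc.mono hsub).mul S.vc.continuousOn)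
    · rw [interior_Icc]
      intro t ht
      have htb : t ∈ Ioo 0 b := ⟨ht.1, ht.2.trans hr⟩
      have d := (((S.dw t htb).mul (S₂.dv t htb)).sub ((S₂.dw t htb).mul (S.dv t htb))).deriv
      have d' : deriv (fun t => (t ^ β * f t * h t) * v₂ t - (t ^ β * f t * h₂ t) * v t) t = 
        t ^ β * (q t - q₂ t) * v t * v₂ t := by
        refine Eq.trans d ?_
        ring
      rw [d']
      have a1 := h1 t ht
      have a2 := h2 t ht
      have a3 := sub_pos.2 (hq t ht)
      have a4 := Real.rpow_pos_of_pos ht.1 β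
      positivity
  have := mono (left_mem_Icc.2 hr0.le) (right_mem_Icc.2 hr0.le) hr0
  simp [S.h0, S₂.h0, e1, e2] at this

end SLSol

/-! ## The ground state curve of the two-parameter radial problem -/

lemma ground_curve {b β r κ0 κ1 c : ℝ} {f q0 A B : ℝ → ℝ} (hβ : 0 ≤ β)
    (hf : ContinuousOn f (Icc 0 b)) (hfp : ∀ t ∈ Icc 0 b, 0 < f t)
    (hq0 : ContinuousOn q0 (Icc 0 b)) (hA : ContinuousOn A (Icc 0 b)) (hB : ContinuousOn B (Icc 0 b))
    (hBp : ∀ t ∈ Icc 0 b, 0 < B t) (hr0 : 0 < r) (hr : r < b) (hκ : κ0 < κ1) (hc : 0 < c)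
    (h1 : ∀ t ∈ Icc 0 r, c * t ^ 2 ≤ A t - κ0 * B t) (h2 : A 0 - κ1 * B 0 < 0) :
    ∃ (μ0 : ℝ) (κ : ℝ → ℝ), ∀ μ1, μ0 ≤ μ1 → Continuous (fun μ => κ (max μ1 μ)) ∧
      ∀ μ, μ1 ≤ μ → κ0 < κ μ ∧ κ μ ≤ κ1 ∧
        ∃ v h : ℝ → ℝ, SLSol b β f (fun t => q0 t + μ * (A t - κ μ * B t)) v h ∧ v r = 0 := by
  have hb : 0 < b := hr0.trans hr
  have hrsub : Icc 0 r ⊆ Icc 0 b := Icc_subset_Icc_right hr.le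
  have qc : ContinuousOn (fun z : (ℝ × ℝ) × ℝ => q0 z.2 + z.1.2 * (A z.2 - z.1.1 * B z.2)) (univ ×ˢ Icc 0 b) := by
    have hs : ∀ {g : ℝ → ℝ}, ContinuousOn g (Icc 0 b) → 
        ContinuousOn (fun z : (ℝ × ℝ) × ℝ => g z.2) (univ ×ˢ Icc 0 b) := fun hg =>
      hg.comp continuousOn_snd (fun z hz => hz.2)
    have c1 : ContinuousOn (fun z : (ℝ × ℝ) × ℝ => z.1.2) (univ ×ˢ Icc 0 b) := by fun_prop
    have c2 : ContinuousOn (fun z : (ℝ × ℝ) × ℝ => z.1.1) (univ ×ˢ Icc 0 b) := by fun_prop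
    exact (hs hq0).add (c1.mul ((hs hA).sub (c2.mul (hs hB))))
  obtain ⟨v, h, cv, ch, v0, h0, dv, dw⟩ := volterra (P := ℝ × ℝ) hb hβ hf hfp
    (q := fun p t => q0 t + p.2 * (A t - p.1 * B t)) qc
  have Sol : ∀ κ μ : ℝ, SLSol b β f (fun t => q0 t + μ * (A t - κ * B t)) (v (κ, μ)) (h (κ, μ)) := by
    intro κ μ
    exact ⟨hb, hβ, hf, hfp, hq0.add (continuousOn_const.mul (hA.sub (continuousOn_const.mul hB))),
      cv.comp (Continuous.prodMk_right (κ, μ)), ch.comp (Continuous.prodMk_right (κ, μ)), v0 _, h0 _, dv _, dw _⟩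
  obtain ⟨K0', hK0'⟩ := isCompact_Icc.exists_bound_of_continuousOn hq0
  set K0 := max 0 K0' with hK0d
  have hK0 : ∀ t ∈ Icc 0 b, |q0 t| ≤ K0 := fun t ht => (hK0' t ht).trans (le_max_right _ _)
  have hK00 : 0 ≤ K0 := le_max_left _ _
  obtain ⟨F, hF⟩ : ∃ F, ∀ t ∈ Icc 0 b, 1 / f t ≤ F := by
    obtain ⟨x, hx, hmin⟩ := isCompact_Icc.exists_isMinOn (nonempty_Icc.2 hb.le) hf
    exact ⟨1 / f x, fun t ht => one_div_le_one_div_of_le (hfp x hx) (hmin ht)⟩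
  -- zone where the potential is negative for κ1
  obtain ⟨r', hr'0, hr'r, δ, hδ, hneg⟩ : ∃ r', 0 < r' ∧ r' < r ∧ ∃ δ > 0, ∀ t ∈ Icc 0 r', A t - κ1 * B t ≤ -δ := by
    have hcont : ContinuousWithinAt (fun t => A t - κ1 * B t) (Icc 0 b) 0 :=
      (hA.sub (continuousOn_const.mul hB)) 0 ⟨le_rfl, hb.le⟩
    set δ := -(A 0 - κ1 * B 0) / 2 with hδ
    have hδ0 : 0 < δ := by simp only [hδ]; linarith
    have hev : ∀ᶠ t in 𝓝[Icc 0 b] (0:ℝ), A t - κ1 * B t < -δ :=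
      hcont.eventually_lt_const (by simp only [hδ]; linarith)
    rw [eventually_nhdsWithin_iff, Metric.eventually_nhds_iff] at hev
    obtain ⟨ε, hε, hev⟩ := hev
    refine ⟨min (ε / 2) (r / 2), by positivity, (min_le_right _ _).trans_lt (by linarith), δ, hδ0, ?_⟩
    intro t ht
    have t1 : t ≤ ε / 2 := ht.2.trans (min_le_left _ _)
    have t2 : t ≤ r / 2 := ht.2.trans (min_le_right _ _)
    refine (hev (y := t) ?_ ⟨ht.1, by linarith⟩).le
    rw [Real.dist_eq, sub_zero, abs_of_nonneg ht.1]; linarith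
  obtain ⟨L, hL⟩ := SLSol.exists_nonpos hβ hf hr'0 (hr'r.trans hr)
  set C := K0 / (β + 1) with hC
  have hC0 : 0 ≤ C := by positivity
  set μ0 := max 1 (max (C ^ 2 * F / c) ((K0 + L) / δ)) with hμ0
  have hμ0a : 1 ≤ μ0 := le_max_left _ _
  have hμ0b : C ^ 2 * F / c ≤ μ0 := (le_max_left _ _).trans (le_max_right _ _)
  have hμ0c : (K0 + L) / δ ≤ μ0 := (le_max_right _ _).trans (le_max_right _ _)
  set m : ℝ × ℝ → ℝ := fun p => sInf (v p '' Icc 0 r) with hm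
  have mc : Continuous m := isCompact_Icc.continuous_sInf (f := v) cv
  have hne : (Icc (0:ℝ) r).Nonempty := nonempty_Icc.2 hr0.le
  have mex : ∀ p, ∃ t ∈ Icc 0 r, m p = v p t := fun p =>
    isCompact_Icc.exists_sInf_image_eq hne (cv.comp (Continuous.prodMk_right p)).continuousOn
  have mle : ∀ p, ∀ t ∈ Icc 0 r, m p ≤ v p t := fun p t ht =>
    csInf_le (isCompact_Icc.bddBelow_image (cv.comp (Continuous.prodMk_right p)).continuousOn) ⟨t, ht, rfl⟩
  have mpos : ∀ μ, μ0 ≤ μ → 0 < m (κ0, μ) := by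
    intro μ hμ
    obtain ⟨t, ht, e⟩ := mex (κ0, μ)
    rw [e]
    refine (Sol κ0 μ).pos_of_bound hr hC0 ?_ t ht
    intro t ht
    have htr : t ∈ Icc 0 r := ⟨ht.1.le, ht.2.le⟩
    have a1 := abs_le.1 (hK0 t (hrsub htr))
    have a2 := h1 t htr
    have a3 : C * (β + 1) = K0 := by simp only [hC]; field_simp
    have a4 : C ^ 2 * t ^ 2 / f t ≤ C ^ 2 * t ^ 2 * F := by
      rw [div_eq_mul_one_div]
      exact mul_le_mul_of_nonneg_left (hF t (hrsub htr)) (by positivity)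
    have a5 : C ^ 2 * F ≤ μ * c := by
      rw [div_le_iff₀ hc] at hμ0b
      exact hμ0b.trans (by gcongr)
    have a6 : C ^ 2 * F * t ^ 2 ≤ μ * c * t ^ 2 := by gcongr
    have a7 : μ * (c * t ^ 2) ≤ μ * (A t - κ0 * B t) := by
      have : 0 ≤ μ := by linarith
      gcongr
    nlinarith
  have mneg : ∀ μ, μ0 ≤ μ → m (κ1, μ) ≤ 0 := by
    intro μ hμ
    obtain ⟨t, ht, e⟩ := hL _ _ _ (Sol κ1 μ) (by
      intro t ht
      have a1 := abs_le.1 (hK0 t ⟨ht.1.le, (ht.2.trans (hr'r.trans hr)).le⟩)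
      have a2 := hneg t ⟨ht.1.le, ht.2.le⟩
      have a3 : K0 + L ≤ μ * δ := by
        rw [div_le_iff₀ hδ] at hμ0c
        exact hμ0c.trans (by gcongr)
      have : 0 ≤ μ := by linarith
      nlinarith)
    exact (mle _ t ⟨ht.1, ht.2.trans hr'r.le⟩).trans e
  have ground : ∀ κ μ, m (κ, μ) = 0 → v (κ, μ) r = 0 ∧ ∀ t ∈ Ioo 0 r, 0 < v (κ, μ) t := by
    intro κ μ hmz
    have hn : ∀ t ∈ Icc 0 r, 0 ≤ v (κ, μ) t := fun t ht => hmz ▸ mle (κ, μ) t ht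
    obtain ⟨t, ht, e⟩ := mex (κ, μ)
    rw [hmz] at e
    have := (Sol κ μ).zero_end hr hn ht e.symm
    refine ⟨this ▸ e.symm, fun s hs => lt_of_le_of_ne (hn s ⟨hs.1.le, hs.2.le⟩) (fun h0 => ?_)⟩
    have := (Sol κ μ).zero_end hr hn ⟨hs.1.le, hs.2.le⟩ h0.symm
    linarith [hs.2]
  have uniq : ∀ μ, μ0 ≤ μ → ∀ κ κ', m (κ, μ) = 0 → m (κ', μ) = 0 → ¬ κ < κ' := by
    intro μ hμ κ κ' e e' hlt
    obtain ⟨g1, g2⟩ := ground κ μ e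
    obtain ⟨g1', g2'⟩ := ground κ' μ e'
    refine (Sol κ μ).ground_unique (Sol κ' μ) hr0 hr ?_ g2 g2' g1 g1'
    intro t ht
    have := hBp t ⟨ht.1.le, (ht.2.trans hr).le⟩
    have h3 : 0 < μ := by linarith
    have : 0 < μ * ((κ' - κ) * B t) := mul_pos h3 (mul_pos (sub_pos.2 hlt) this)
    nlinarith
  have ex : ∀ μ, ∃ κ, μ0 ≤ μ → κ ∈ Icc κ0 κ1 ∧ m (κ, μ) = 0 := by
    intro μ
    by_cases hμ : μ0 ≤ μ
    · have hcont : ContinuousOn (fun κ => m (κ, μ)) (Icc κ0 κ1) :=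
        (mc.comp (Continuous.prodMk_left μ)).continuousOn
      have := intermediate_value_Icc' hκ.le hcont ⟨mneg μ hμ, (mpos μ hμ).le⟩
      obtain ⟨κ, hk, e⟩ := this
      exact ⟨κ, fun _ => ⟨hk, e⟩⟩
    · exact ⟨0, fun h => absurd h hμ⟩
  choose κ hκm using ex
  refine ⟨μ0, κ, fun μ1 hμ1 => ⟨?_, ?_⟩⟩
  · rw [continuous_iff_continuousAt]
    intro μ
    apply isCompact_Icc.tendsto_nhds_of_unique_mapClusterPt (s := Icc κ0 κ1)
    · exact Filter.Eventually.of_forall (fun x => (hκm _ (hμ1.trans (le_max_left _ _))).1)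
    · intro y hy hcl
      have hmμ := hμ1.trans (le_max_left μ1 μ)
      have hz : m (y, max μ1 μ) = 0 := by
        by_contra hne
        have hcm : Continuous (fun z : ℝ × ℝ => m (z.1, max μ1 z.2)) := by fun_prop
        have hop : IsOpen {z : ℝ × ℝ | m (z.1, max μ1 z.2) ≠ 0} := isOpen_ne_fun hcm continuous_const
        have hnb := hop.mem_nhds (show (y, μ) ∈ _ from hne)
        rw [nhds_prod_eq, Filter.mem_prod_iff] at hnb
        obtain ⟨U, hU, V, hV, hUV⟩ := hnb
        have hfr := (hcl.frequently hU).and_eventually hV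
        obtain ⟨x, hxU, hxV⟩ := hfr.exists
        exact hUV (Set.mk_mem_prod hxU hxV) (hκm _ (hμ1.trans (le_max_left _ _))).2
      have hz' := (hκm _ hmμ).2
      exact le_antisymm (not_lt.1 (uniq _ hmμ _ _ hz' hz)) (not_lt.1 (uniq _ hmμ _ _ hz hz'))
  · intro μ hμ
    have hμ' := hμ1.trans hμ
    obtain ⟨hk, e⟩ := hκm μ hμ'
    refine ⟨lt_of_le_of_ne hk.1 (fun h => ?_), hk.2, v (κ μ, μ), h (κ μ, μ), Sol _ _, (ground _ _ e).1⟩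
    have := mpos μ hμ'
    rw [h, e] at this
    exact lt_irrefl _ this

/-! ## The radial equation in the inverse radius -/

noncomputable def rf (M l a t : ℝ) : ℝ := 1 / l ^ 2 + t ^ 2 - 2 * M * t ^ 3 / (1 + a ^ 2 * t ^ 2)

noncomputable def rf' (M a t : ℝ) : ℝ :=
  2 * t - 2 * M * t ^ 2 * (3 + a ^ 2 * t ^ 2) / (1 + a ^ 2 * t ^ 2) ^ 2

noncomputable def rq0 (M l a α s t : ℝ) : ℝ :=
  (-(2 * a ^ 2 / (l ^ 2 * (1 + a ^ 2 * t ^ 2) ^ 2)) - 3 / (1 + a ^ 2 * t ^ 2) ^ 2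
    + 6 * M * t / (1 + a ^ 2 * t ^ 2) ^ 3
    + (3 * (1 + a ^ 2 / l ^ 2) - 4 * M * t + a ^ 2 * t ^ 2) / (1 + a ^ 2 * t ^ 2) ^ 2)
  + (2 - α) * (-(a ^ 2 / l ^ 2) / (1 + a ^ 2 * t ^ 2) - 1 + 2 * M * t / (1 + a ^ 2 * t ^ 2))
  - s * (2 - 2 * M * t * (3 + a ^ 2 * t ^ 2) / (1 + a ^ 2 * t ^ 2) ^ 2)
  - α / l ^ 2 * Th α * a ^ 2 / (1 + a ^ 2 * t ^ 2)

lemma Dpos (a t : ℝ) : 0 < 1 + a ^ 2 * t ^ 2 := by positivity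

lemma rf_eq {M l a r : ℝ} (hl : 0 < l) (hr : 0 < r) :
    rf M l a r⁻¹ = Dm M l a r / (r ^ 2 + a ^ 2) / r ^ 2 := by
  have : 0 < r ^ 2 + a ^ 2 := by positivity
  unfold rf Dm
  have h2 := Dpos a r⁻¹
  have e : 1 + a ^ 2 * r⁻¹ ^ 2 = (r ^ 2 + a ^ 2) / r ^ 2 := by field_simp
  rw [e]
  field_simp
  ring

lemma rf_deriv (M l a t : ℝ) : HasDerivAt (rf M l a) (rf' M a t) t := by
  have h2 := Dpos a t
  have h := (((hasDerivAt_id t).pow 2).const_add (1 / l ^ 2)).sub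
    ((((hasDerivAt_id t).pow 3).const_mul (2 * M)).div
      ((((hasDerivAt_id t).pow 2).const_mul (a ^ 2)).const_add 1) h2.ne')
  refine h.congr_deriv ?_
  unfold rf'
  simp only [id, Pi.pow_apply]
  field_simp
  ring

lemma rf_cont (M l a : ℝ) : Continuous (rf M l a) :=
  continuous_iff_continuousAt.2 (fun t => (rf_deriv M l a t).continuousAt)

lemma rq0_cont (M l a α s : ℝ) : Continuous (rq0 M l a α s) := by
  have h (t : ℝ) : (1 + a ^ 2 * t ^ 2) ≠ 0 := (Dpos a t).ne'
  have h2 (t : ℝ) : (1 + a ^ 2 * t ^ 2) ^ 2 ≠ 0 := pow_ne_zero _ (h t)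
  have h3 (t : ℝ) : (1 + a ^ 2 * t ^ 2) ^ 3 ≠ 0 := pow_ne_zero _ (h t)
  by_cases hl : l = 0
  · subst hl
    unfold rq0
    simp
    fun_prop (disch := intro x; first | exact h x | exact h2 x | exact h3 x)
  have h4 (t : ℝ) : l ^ 2 * (1 + a ^ 2 * t ^ 2) ^ 2 ≠ 0 := mul_ne_zero (pow_ne_zero _ hl) (h2 t)
  unfold rq0
  fun_prop (disch := intro x; first | exact h x | exact h2 x | exact h3 x | exact h4 x)

lemma pot_identity {M l a α s r μ κ : ℝ} (hl : 0 < l) (hr : 0 < r) (hs : s * (s - 1) = 2 - α)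
    (hf : rf M l a r⁻¹ ≠ 0) :
    μ * Vsig M l a r + Vjunk M l a α r + Vmass M l a α r - κ * μ =
      rf M l a r⁻¹ * (s * rf' M a r⁻¹ / r⁻¹ + s * (s - 1) * rf M l a r⁻¹ / r⁻¹ ^ 2 +
        (rq0 M l a α s r⁻¹ + μ * (1 / (1 + a ^ 2 * r⁻¹ ^ 2) - κ * (1 / rf M l a r⁻¹)))) := by
  rw [hs]
  have hD : 0 < r ^ 2 + a ^ 2 := by positivity
  have e : 1 + a ^ 2 * r⁻¹ ^ 2 = (r ^ 2 + a ^ 2) / r ^ 2 := by field_simp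
  have e1 : rf M l a r⁻¹ * (rq0 M l a α s r⁻¹ + μ * (1 / (1 + a ^ 2 * r⁻¹ ^ 2) - κ * (1 / rf M l a r⁻¹)))
     = rf M l a r⁻¹ * (rq0 M l a α s r⁻¹ + μ * (1 / (1 + a ^ 2 * r⁻¹ ^ 2))) - κ * μ := by
    generalize rf M l a r⁻¹ = F at hf ⊢
    generalize rq0 M l a α s r⁻¹ = G
    generalize 1 / (1 + a ^ 2 * r⁻¹ ^ 2) = H
    field_simp
    ring
  rw [mul_add, e1]
  have e2 : rq0 M l a α s r⁻¹ + s * rf' M a r⁻¹ / r⁻¹ = rq0 M l a α 0 r⁻¹ := by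
    unfold rq0 rf'
    rw [e]
    field_simp
    ring
  have e3 : rf M l a r⁻¹ * (s * rf' M a r⁻¹ / r⁻¹ + (2 - α) * rf M l a r⁻¹ / r⁻¹ ^ 2)
     + (rf M l a r⁻¹ * (rq0 M l a α s r⁻¹ + μ * (1 / (1 + a ^ 2 * r⁻¹ ^ 2))) - κ * μ) =
     rf M l a r⁻¹ * (rq0 M l a α 0 r⁻¹ + (2 - α) * rf M l a r⁻¹ / r⁻¹ ^ 2 + μ * (1 / (1 + a ^ 2 * r⁻¹ ^ 2))) - κ * μ := by
    rw [← e2]; ring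
  rw [e3]
  have e4 : rq0 M l a α 0 r⁻¹ + (2 - α) * rf M l a r⁻¹ / r⁻¹ ^ 2 + μ * (1 / (1 + a ^ 2 * r⁻¹ ^ 2)) =
     (r ^ 2 / (r ^ 2 + a ^ 2)) * (μ - 3 * r ^ 2 * Dm M l a r / (r ^ 2 + a ^ 2) ^ 2 +
       (5*r^4/l^2 + 3*r^2*(1+a^2/l^2) - 4*M*r + a^2)/(r^2+a^2) - 2 / l ^ 2 * r ^ 2 - α / l ^ 2 * Th α * a ^ 2
        + (2 - α) / l ^ 2 * r ^ 2) := by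
    unfold rq0 rf Dm
    rw [e]
    field_simp
    ring
  rw [e4, rf_eq hl hr]
  unfold Vsig Vjunk Vmass
  field_simp
  ring

lemma radial_deriv {b s f' t : ℝ} {f q v h : ℝ → ℝ} (S : SLSol b (2 * s) f q v h) (ht : t ∈ Ioo 0 b)
    (hf : HasDerivAt f f' t) :
    HasDerivAt (fun t => t ^ s * v t) (t ^ (s - 1) * (s * v t + t * h t)) t ∧
    HasDerivAt (fun t => f t * (t ^ (s - 1) * (s * v t + t * h t)))
      ((s * f' / t + s * (s - 1) * f t / t ^ 2 + q t) * (t ^ s * v t)) t := by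
  have t0 := ht.1
  have ex : ∀ x : ℝ, 0 < x → x ^ s = x ^ (s - 1) * x := by
    intro x hx
    rw [← Real.rpow_add_one hx.ne', sub_add_cancel]
  have d1 := Real.hasDerivAt_rpow_const (x := t) (p := s) (Or.inl t0.ne')
  have d2 := Real.hasDerivAt_rpow_const (x := t) (p := s - 1) (Or.inl t0.ne')
  have d3 := Real.hasDerivAt_rpow_const (x := t) (p := -s) (Or.inl t0.ne')
  refine ⟨(d1.mul (S.dv t ht)).congr_deriv ?_, ?_⟩
  · rw [ex t t0]; ring
  · have h1 := ((hf.mul d2).const_mul s).mul (S.dv t ht)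
    have h2 := d3.mul (S.dw t ht)
    have h3 := h1.add h2
    have ev : (fun t => f t * (t ^ (s - 1) * (s * v t + t * h t))) =ᶠ[𝓝 t]
        fun x => (s * (f x * x ^ (s - 1))) * v x + x ^ (-s) * (x ^ (2 * s) * f x * h x) := by
      filter_upwards [lt_mem_nhds t0] with x hx
      have e1 : x ^ (2 * s) = x ^ s * x ^ s := by rw [← Real.rpow_add hx]; ring_nf
      rw [Real.rpow_neg hx.le, e1]
      have := (Real.rpow_pos_of_pos hx s).ne'
      have e2 : (x ^ s)⁻¹ * (x ^ s * x ^ s * f x * h x) = x ^ s * f x * h x := by field_simp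
      rw [e2, ex x hx]
      ring
    refine (h3.congr_of_eventuallyEq (ev.trans (Eventually.of_forall fun x => ?_))).congr_deriv ?_
    · simp only [Pi.add_apply, Pi.mul_apply]
    · simp only [Pi.mul_apply]
      have e1 : t ^ (2 * s) = t ^ s * t ^ s := by rw [← Real.rpow_add t0]; ring_nf
      have e3 : t ^ (-s - 1) = (t ^ s)⁻¹ * t⁻¹ := by
        rw [Real.rpow_sub_one t0.ne', Real.rpow_neg t0.le]; rfl
      have e4 : t ^ (s - 1 - 1) = t ^ s * t⁻¹ * t⁻¹ := by
        rw [Real.rpow_sub_one t0.ne', Real.rpow_sub_one t0.ne']; rfl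
      have e5 : t ^ (s - 1) = t ^ s * t⁻¹ := by
        rw [Real.rpow_sub_one t0.ne']; rfl
      rw [Real.rpow_neg t0.le, e1, e3, e4, e5]
      have := (Real.rpow_pos_of_pos t0 s).ne'
      field_simp
      ring

lemma radial_state {M l a α rp rmax xmax b s μ κ : ℝ} {R v h : ℝ → ℝ} (hl : 0 < l)
    (hrp : 0 < rp) (hrmax : rp < rmax)
    (hRmono : StrictMonoOn R (Set.Iio (π/2)))
    (hRim : R '' Set.Iio (π/2) = Set.Ioi rp)
    (hRderiv : ∀ x < π/2, HasDerivAt R (Dm M l a (R x) / ((R x)^2 + a^2)) x)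
    (hRtop : Filter.Tendsto R (nhdsWithin (π/2) (Set.Iio (π/2))) Filter.atTop)
    (hxmax : xmax < π/2) (hRxmax : R xmax = rmax) (hb : rmax⁻¹ < b)
    (hs : 1 / 2 < s) (hs2 : s * (s - 1) = 2 - α)
    (S : SLSol b (2 * s) (rf M l a)
      (fun t => rq0 M l a α s t + μ * (1 / (1 + a ^ 2 * t ^ 2) - κ * (1 / rf M l a t))) v h)
    (hv : v rmax⁻¹ = 0) :
    ∃ u : ℝ → ℝ,
        (∃ x ∈ Set.Ico xmax (π/2), u x ≠ 0) ∧
        ContDiffOn ℝ 2 u (Set.Ico xmax (π/2)) ∧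
        (∀ x ∈ Set.Ioo xmax (π/2),
          -(deriv (deriv u) x)
            + (μ * Vsig M l a (R x) + Vjunk M l a α (R x) + Vmass M l a α (R x)) * u x
          = κ * μ * u x) ∧
        u xmax = 0 ∧
        MeasureTheory.IntegrableOn
          (fun x => (deriv u x)^2 + (R x)^2 * (u x)^2) (Set.Ioo xmax (π/2)) := by
  have Rpos : ∀ x < π / 2, 0 < R x := by
    intro x hx
    have : R x ∈ R '' Set.Iio (π/2) := ⟨x, hx, rfl⟩
    rw [hRim] at this
    exact hrp.trans this
  set ρ : ℝ → ℝ := fun x => (R x)⁻¹ with hρ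
  have ρpos : ∀ x < π / 2, 0 < ρ x := fun x hx => inv_pos.2 (Rpos x hx)
  have ρd : ∀ x < π / 2, HasDerivAt ρ (-(rf M l a (ρ x))) x := by
    intro x hx
    have := (hRderiv x hx).inv (Rpos x hx).ne'
    refine this.congr_deriv ?_
    rw [hρ]
    simp only
    rw [rf_eq hl (Rpos x hx)]
    ring
  have ρc : ContinuousOn ρ (Iio (π / 2)) := fun x hx => (ρd x hx).continuousAt.continuousWithinAt
  set O : Set ℝ := Iio (π / 2) ∩ ρ ⁻¹' (Iio b) with hO
  have Oo : IsOpen O := ρc.isOpen_inter_preimage isOpen_Iio isOpen_Iio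
  have ρO : ∀ x ∈ O, ρ x ∈ Ioo 0 b := fun x hx => ⟨ρpos x hx.1, hx.2⟩
  have ρle : ∀ x ∈ Ico xmax (π / 2), ρ x ≤ rmax⁻¹ := by
    intro x hx
    rw [← hRxmax]
    exact inv_anti₀ (Rpos _ hxmax) (hRmono.monotoneOn hxmax hx.2 hx.1)
  have sub : Ico xmax (π / 2) ⊆ O := fun x hx => ⟨hx.2, (ρle x hx).trans_lt hb⟩
  have ρt : Tendsto ρ (𝓝[<] (π / 2)) (𝓝 0) := tendsto_inv_atTop_zero.comp hRtop
  set f := rf M l a with hfd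
  set G : ℝ → ℝ := fun t => f t * (t ^ (s - 1) * (s * v t + t * h t)) with hG
  set Q : ℝ → ℝ := fun t => (s * rf' M a t / t + s * (s - 1) * f t / t ^ 2 +
    (rq0 M l a α s t + μ * (1 / (1 + a ^ 2 * t ^ 2) - κ * (1 / f t)))) with hQ
  set U : ℝ → ℝ := fun t => t ^ s * v t with hU
  have fpos : ∀ t ∈ Icc 0 b, 0 < f t := S.fp
  have du : ∀ x ∈ O, HasDerivAt (fun x => U (ρ x)) (-G (ρ x)) x := by
    intro x hx
    have := (radial_deriv S (ρO x hx) (rf_deriv M l a (ρ x))).1.comp x (ρd x hx.1)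
    exact this.congr_deriv (by simp only [hG]; ring)
  have dG : ∀ x ∈ O, HasDerivAt (fun x => -G (ρ x)) (f (ρ x) * Q (ρ x) * U (ρ x)) x := by
    intro x hx
    have := (radial_deriv S (ρO x hx) (rf_deriv M l a (ρ x))).2.comp x (ρd x hx.1)
    exact this.neg.congr_deriv (by simp only [hQ, hU]; ring)
  have Uc : ContinuousOn (fun x => U (ρ x)) O := fun x hx => (du x hx).continuousAt.continuousWithinAt
  have pot : ∀ x ∈ O, f (ρ x) * Q (ρ x) =
      μ * Vsig M l a (R x) + Vjunk M l a α (R x) + Vmass M l a α (R x) - κ * μ := by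
    intro x hx
    exact (pot_identity hl (Rpos x hx.1) hs2 (fpos _ ⟨(ρO x hx).1.le, (ρO x hx).2.le⟩).ne').symm
  have Qc : ContinuousOn (fun x => f (ρ x) * Q (ρ x)) O := by
    have hρc : ContinuousOn ρ O := ρc.mono inter_subset_left
    have h0 : ∀ x ∈ O, ρ x ≠ 0 := fun x hx => (ρpos x hx.1).ne'
    have hfc : ContinuousOn (fun x => f (ρ x)) O := (rf_cont M l a).comp_continuousOn hρc
    have hf0 : ∀ x ∈ O, f (ρ x) ≠ 0 := fun x hx => (fpos _ ⟨(ρO x hx).1.le, (ρO x hx).2.le⟩).ne'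
    have hqc : ContinuousOn (fun x => rq0 M l a α s (ρ x)) O := (rq0_cont M l a α s).comp_continuousOn hρc
    have hD : ∀ x ∈ O, 1 + a ^ 2 * ρ x ^ 2 ≠ 0 := fun x _ => (Dpos a (ρ x)).ne'
    have hD2 : ∀ x ∈ O, (1 + a ^ 2 * ρ x ^ 2) ^ 2 ≠ 0 := fun x hx => pow_ne_zero _ (hD x hx)
    have hf'c : ContinuousOn (fun x => rf' M a (ρ x)) O := by
      unfold rf'
      fun_prop (disch := assumption)
    have h02 : ∀ x ∈ O, ρ x ^ 2 ≠ 0 := fun x hx => pow_ne_zero _ (h0 x hx)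
    have c1 : ContinuousOn (fun x => 1 + a ^ 2 * ρ x ^ 2) O := by fun_prop
    exact hfc.mul ((((continuousOn_const.mul hf'c).div hρc h0).add
      ((continuousOn_const.mul hfc).div (hρc.pow 2) h02)).add
      (hqc.add (continuousOn_const.mul ((continuousOn_const.div c1 hD).sub
        (continuousOn_const.mul (continuousOn_const.div hfc hf0))))))
  have deru : ∀ x ∈ O, deriv (fun x => U (ρ x)) x = -G (ρ x) := fun x hx => (du x hx).deriv
  have derG : ∀ x ∈ O, deriv (fun x => -G (ρ x)) x = f (ρ x) * Q (ρ x) * U (ρ x) := fun x hx => (dG x hx).deriv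
  have deru2 : ∀ x ∈ O, deriv (deriv (fun x => U (ρ x))) x = f (ρ x) * Q (ρ x) * U (ρ x) := by
    intro x hx
    rw [← derG x hx]
    apply Filter.EventuallyEq.deriv_eq
    filter_upwards [Oo.mem_nhds hx] with y hy using deru y hy
  refine ⟨fun x => U (ρ x), ?_, ?_, ?_, ?_, ?_⟩
  · have hev : ∀ᶠ t in 𝓝 (0:ℝ), 0 < v t :=
      S.vc.continuousAt.eventually (lt_mem_nhds (by rw [S.v0]; exact one_pos))
    have h1 := ρt.eventually hev
    have h2 : ∀ᶠ x in 𝓝[<] (π / 2), x ∈ Ico xmax (π / 2) := Ico_mem_nhdsLT hxmax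
    obtain ⟨x, hx1, hx2⟩ := (h1.and h2).exists
    exact ⟨x, hx2, (mul_pos (Real.rpow_pos_of_pos (ρpos x hx2.2) _) hx1).ne'⟩
  · refine ContDiffOn.mono ?_ sub
    have h2 : (2 : WithTop ℕ∞) = 1 + 1 := by norm_num
    rw [h2, contDiffOn_succ_iff_deriv_of_isOpen Oo]
    refine ⟨fun x hx => (du x hx).differentiableAt.differentiableWithinAt, by simp, ?_⟩
    have h1 : (1 : WithTop ℕ∞) = 0 + 1 := by norm_num
    refine ContDiffOn.congr ?_ deru
    rw [h1, contDiffOn_succ_iff_deriv_of_isOpen Oo]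
    refine ⟨fun x hx => (dG x hx).differentiableAt.differentiableWithinAt, by simp, ?_⟩
    refine ContDiffOn.congr ?_ derG
    rw [contDiffOn_zero]
    exact Qc.mul Uc
  · intro x hx
    have hx' := sub ⟨hx.1.le, hx.2⟩
    rw [deru2 x hx', pot x hx']
    ring
  · show U (ρ xmax) = 0
    have : ρ xmax = rmax⁻¹ := by simp only [hρ, hRxmax]
    simp only [hU]
    rw [this, hv, mul_zero]
  · -- integrability
    have h2s : 0 < 2 * s - 1 := by linarith
    set g : ℝ → ℝ := fun x => -(Function.update ρ (π / 2) 0 x) ^ (2 * s - 1) with hg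
    have gc : ContinuousOn g (Icc xmax (π / 2)) := by
      refine ContinuousOn.neg ?_
      refine (Real.continuous_rpow_const h2s.le).comp_continuousOn ?_
      rw [continuousOn_update_iff]
      refine ⟨ρc.mono (fun x hx => lt_of_le_of_ne hx.1.2 hx.2), fun _ => ρt.mono_left ?_⟩
      exact nhdsWithin_mono _ (fun x hx => lt_of_le_of_ne hx.1.2 hx.2)
    have gd : ∀ x ∈ Ioo xmax (π / 2), HasDerivAt g ((2 * s - 1) * ρ x ^ (2 * s - 2) * f (ρ x)) x := by
      intro x hx
      have := ((ρd x hx.2).rpow_const (p := 2 * s - 1) (Or.inl (ρpos x hx.2).ne')).neg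
      have ev : g =ᶠ[𝓝 x] fun y => -(ρ y) ^ (2 * s - 1) := by
        filter_upwards [gt_mem_nhds hx.2] with y hy
        simp only [hg]
        rw [Function.update_of_ne (ne_of_lt hy)]
      refine (this.congr_of_eventuallyEq ev).congr_deriv ?_
      rw [show 2 * s - 1 - 1 = 2 * s - 2 by ring]
      ring
    have fx : ∀ x ∈ Ioo xmax (π / 2), 0 < f (ρ x) := fun x hx =>
      fpos _ ⟨(ρO x (sub ⟨hx.1.le, hx.2⟩)).1.le, (ρO x (sub ⟨hx.1.le, hx.2⟩)).2.le⟩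
    have gi := intervalIntegral.integrableOn_deriv_of_nonneg gc gd (fun x hx =>
      mul_nonneg (mul_nonneg h2s.le (Real.rpow_nonneg (ρpos x hx.2).le _)) (fx x hx).le)
    have gi' := gi.mono_set (Ioo_subset_Ioc_self)
    set K : ℝ → ℝ := fun t => ((f t * (s * v t + t * h t)) ^ 2 + v t ^ 2) / ((2 * s - 1) * f t) with hK
    have Kc : ContinuousOn K (Icc 0 b) := by
      have hf0 : ∀ t ∈ Icc 0 b, (2 * s - 1) * f t ≠ 0 := fun t ht => (mul_pos h2s (fpos t ht)).ne'
      have := S.vc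
      have := S.hc
      have := S.fc
      refine ContinuousOn.div ?_ (continuousOn_const.mul S.fc) hf0
      fun_prop
    obtain ⟨C, hC⟩ := isCompact_Icc.exists_bound_of_continuousOn Kc
    have mem : ∀ x ∈ Ioo xmax (π / 2), ρ x ∈ Icc 0 b := fun x hx =>
      Ioo_subset_Icc_self (ρO x (sub ⟨hx.1.le, hx.2⟩))
    have Km : AEStronglyMeasurable (fun x => K (ρ x)) (volume.restrict (Ioo xmax (π / 2))) := by
      apply ContinuousOn.aestronglyMeasurable _ measurableSet_Ioo
      exact Kc.comp (ρc.mono (fun x hx => hx.2)) mem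
    have fin := Integrable.bdd_mul gi' Km (c := C) (by
      rw [ae_restrict_iff' measurableSet_Ioo]
      exact Eventually.of_forall (fun x hx => hC _ (mem x hx)))
    refine (integrableOn_congr_fun ?_ measurableSet_Ioo).2 fin
    intro x hx
    have hx' := sub ⟨hx.1.le, hx.2⟩
    simp only
    rw [deru x hx']
    have r0 := ρpos x hx.2
    have f0 := fx x hx
    have eR : R x = (ρ x)⁻¹ := by simp [hρ]
    rw [eR]
    simp only [hG, hU, hK]
    generalize ρ x = t at *
    have e1 : t ^ (2 * s - 2) = t ^ (s - 1) * t ^ (s - 1) := by rw [← Real.rpow_add r0]; ring_nf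
    have e2 : t ^ s = t ^ (s - 1) * t := by rw [← Real.rpow_add_one r0.ne', sub_add_cancel]
    rw [e1, e2]
    have : 2 * s - 1 ≠ 0 := h2s.ne'
    generalize 2 * s - 1 = w at this ⊢
    field_simp

lemma radial_curve {M l a α rp rmax xmax E : ℝ} {R : ℝ → ℝ} (hM : 0 < M) (hl : 0 < l) (ha : |a| < l)
    (hα : α < 9/4) (hrp : 0 < rp) (hrp0 : Dm M l a rp = 0)
    (hrppos : ∀ r, rp < r → 0 < Dm M l a r)
    (hrmax : rp < rmax)
    (hRmono : StrictMonoOn R (Set.Iio (π/2)))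
    (hRim : R '' Set.Iio (π/2) = Set.Ioi rp)
    (hRderiv : ∀ x < π/2, HasDerivAt R (Dm M l a (R x) / ((R x)^2 + a^2)) x)
    (hRtop : Filter.Tendsto R (nhdsWithin (π/2) (Set.Iio (π/2))) Filter.atTop)
    (hxmax : xmax < π/2) (hRxmax : R xmax = rmax)
    (hE : E ∈ Set.Ioo (1/l^2) (Vsig M l a rmax)) :
    ∃ (κ1 μ0 : ℝ) (κ : ℝ → ℝ), κ1 ≤ E ∧ a ^ 2 * κ1 < 1 ∧ 
      ∀ μ1, μ0 ≤ μ1 → Continuous (fun μ => κ (max μ1 μ)) ∧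
      ∀ μ, μ1 ≤ μ → 1 / l ^ 2 < κ μ ∧ κ μ ≤ κ1 ∧ ∃ u : ℝ → ℝ,
        (∃ x ∈ Set.Ico xmax (π/2), u x ≠ 0) ∧
        ContDiffOn ℝ 2 u (Set.Ico xmax (π/2)) ∧
        (∀ x ∈ Set.Ioo xmax (π/2),
          -(deriv (deriv u) x)
            + (μ * Vsig M l a (R x) + Vjunk M l a α (R x) + Vmass M l a α (R x)) * u x
          = κ μ * μ * u x) ∧
        u xmax = 0 ∧
        MeasureTheory.IntegrableOn
          (fun x => (deriv u x)^2 + (R x)^2 * (u x)^2) (Set.Ioo xmax (π/2)) := by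
  have hal : a ^ 2 < l ^ 2 := sq_lt_sq' (by linarith [neg_abs_le a]) (lt_of_abs_lt ha)
  have hl2 : 0 < l ^ 2 := by positivity
  have hrm : 0 < rmax := hrp.trans hrmax
  obtain ⟨s, hs, hs2⟩ : ∃ s : ℝ, 1 / 2 < s ∧ s * (s - 1) = 2 - α := by
    refine ⟨1 / 2 + √(9 / 4 - α), by linarith [Real.sqrt_pos.2 (sub_pos.2 hα)], ?_⟩
    have := Real.sq_sqrt (sub_pos.2 hα).le
    nlinarith
  obtain ⟨b, hb1, hb2⟩ := exists_between (inv_strictAnti₀ hrp hrmax)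
  have hf0 : rf M l a 0 = 1 / l ^ 2 := by simp [rf]
  have fpos : ∀ t ∈ Icc 0 b, 0 < rf M l a t := by
    intro t ht
    rcases ht.1.eq_or_lt with h | h
    · rw [← h, hf0]; positivity
    · have h1 : rp < t⁻¹ := by
        rw [lt_inv_comm₀ hrp h]; exact ht.2.trans_lt hb2
      have := rf_eq (M := M) (a := a) hl (inv_pos.2 h)
      rw [inv_inv] at this
      rw [this]
      have := hrppos _ h1
      have := inv_pos.2 h
      positivity
  set κ1 := min E (2 / (l ^ 2 + a ^ 2)) with hκ1
  have k1 : 1 / l ^ 2 < κ1 := by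
    rw [hκ1, lt_min_iff]
    refine ⟨hE.1, ?_⟩
    rw [div_lt_div_iff₀ hl2 (by positivity)]
    linarith
  have k2 : a ^ 2 * κ1 < 1 := by
    have h1 : a ^ 2 * κ1 ≤ a ^ 2 * (2 / (l ^ 2 + a ^ 2)) :=
      mul_le_mul_of_nonneg_left (min_le_right _ _) (sq_nonneg a)
    have h2 : a ^ 2 * (2 / (l ^ 2 + a ^ 2)) < 1 := by
      rw [← mul_div_assoc, div_lt_one (by positivity)]
      linarith
    linarith
  -- positivity of the leading coefficient
  set ξ := 1 - a ^ 2 / l ^ 2 with hξ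
  have ξ0 : 0 ≤ ξ := by
    rw [hξ, sub_nonneg, div_le_one hl2]; exact hal.le
  set g : ℝ → ℝ := fun t => ξ * (1 + a ^ 2 * t ^ 2) - 2 * M * t with hg
  have gr : ∀ r, 0 < r → g r⁻¹ = (Vsig M l a r - 1 / l ^ 2) * (r ^ 2 + a ^ 2) ^ 2 / r ^ 2 := by
    intro r hr
    have : 0 < r ^ 2 + a ^ 2 := by positivity
    simp only [hg, hξ, Vsig, Dm]
    field_simp
    ring
  have g1 : 0 < g rmax⁻¹ := by
    rw [gr _ hrm]
    have := hE.1.trans hE.2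
    have := sub_pos.2 this
    positivity
  have g2 : g rp⁻¹ < 0 := by
    have : g rp⁻¹ = -((1 / l ^ 2) * (rp ^ 2 + a ^ 2) ^ 2 / rp ^ 2) := by
      rw [gr _ hrp, Vsig, hrp0]; ring
    rw [this, neg_lt_zero]
    positivity
  have gpos : ∀ t ∈ Icc 0 rmax⁻¹, 0 < g t := by
    intro t ht
    by_contra hneg
    push Not at hneg
    have hlt : t < rmax⁻¹ := lt_of_le_of_ne ht.2 (fun e => by rw [e] at hneg; linarith)
    have h3 : rmax⁻¹ < rp⁻¹ := inv_strictAnti₀ hrp hrmax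
    generalize rmax⁻¹ = y at *
    generalize rp⁻¹ = z at *
    have key : (z - t) * g y = (z - y) * g t + (y - t) * g z - ξ * a ^ 2 * (z - y) * (y - t) * (z - t) := by
      simp only [hg]; ring
    have a1 : 0 < (z - t) * g y := mul_pos (by linarith) g1
    have a2 : (z - y) * g t ≤ 0 := mul_nonpos_of_nonneg_of_nonpos (by linarith) hneg
    have a3 : (y - t) * g z ≤ 0 := mul_nonpos_of_nonneg_of_nonpos (by linarith) g2.le
    have a4 : 0 ≤ ξ * a ^ 2 * (z - y) * (y - t) * (z - t) := by
      have := sub_pos.2 h3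
      have := sub_pos.2 hlt
      have : 0 < z - t := by linarith
      positivity
    linarith
  have hAB : ∀ t ∈ Icc 0 b, 1 / (1 + a ^ 2 * t ^ 2) - 1 / l ^ 2 * (1 / rf M l a t) =
      g t / ((1 + a ^ 2 * t ^ 2) ^ 2 * rf M l a t) * t ^ 2 := by
    intro t ht
    have h1 := fpos t ht
    have h2 := Dpos a t
    have e : rf M l a t * (l ^ 2 * (1 + a ^ 2 * t ^ 2)) =
        (1 + l ^ 2 * t ^ 2) * (1 + a ^ 2 * t ^ 2) - 2 * M * t ^ 3 * l ^ 2 := by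
      unfold rf; field_simp
    have e2 : l ^ 2 * rf M l a t * (1 + a ^ 2 * t ^ 2) - (1 + a ^ 2 * t ^ 2) ^ 2 = l ^ 2 * g t * t ^ 2 := by
      have e3 : l ^ 2 * g t = (l ^ 2 - a ^ 2) * (1 + a ^ 2 * t ^ 2) - l ^ 2 * (2 * M * t) := by
        simp only [hg, hξ]; field_simp
      rw [e3]
      linear_combination e
    generalize 1 + a ^ 2 * t ^ 2 = D at *
    generalize rf M l a t = F at *
    calc 1 / D - 1 / l ^ 2 * (1 / F) = (l ^ 2 * F * D - D ^ 2) / (l ^ 2 * (D ^ 2 * F)) := by field_simp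
      _ = _ := by rw [e2]; field_simp
  have hsub : Icc 0 rmax⁻¹ ⊆ Icc 0 b := Icc_subset_Icc_right hb1.le
  have hDc : Continuous (fun t : ℝ => 1 + a ^ 2 * t ^ 2) := by fun_prop
  have hfc := rf_cont M l a
  obtain ⟨c, hc, hcle⟩ : ∃ c, 0 < c ∧ ∀ t ∈ Icc 0 rmax⁻¹, c ≤ g t / ((1 + a ^ 2 * t ^ 2) ^ 2 * rf M l a t) := by
    have hcont : ContinuousOn (fun t => g t / ((1 + a ^ 2 * t ^ 2) ^ 2 * rf M l a t)) (Icc 0 rmax⁻¹) := by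
      refine ContinuousOn.div (by fun_prop) ((hDc.pow 2).mul hfc).continuousOn (fun t ht => ?_)
      exact (mul_pos (pow_pos (Dpos a t) 2) (fpos t (hsub ht))).ne'
    obtain ⟨t0, ht0, hm⟩ := isCompact_Icc.exists_isMinOn (nonempty_Icc.2 (inv_pos.2 hrm).le) hcont
    refine ⟨_, ?_, fun t ht => hm ht⟩
    exact div_pos (gpos _ ht0) (mul_pos (pow_pos (Dpos a t0) 2) (fpos t0 (hsub ht0)))
  obtain ⟨μ0, κ, H⟩ := ground_curve (b := b) (β := 2 * s) (r := rmax⁻¹) (κ0 := 1 / l ^ 2) (κ1 := κ1) (c := c)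
    (f := rf M l a) (q0 := rq0 M l a α s) (A := fun t => 1 / (1 + a ^ 2 * t ^ 2)) (B := fun t => 1 / rf M l a t)
    (by linarith) hfc.continuousOn fpos (rq0_cont M l a α s).continuousOn
    (continuousOn_const.div hDc.continuousOn (fun t _ => (Dpos a t).ne'))
    (continuousOn_const.div hfc.continuousOn (fun t ht => (fpos t ht).ne'))
    (fun t ht => one_div_pos.2 (fpos t ht)) (inv_pos.2 hrm) hb1 k1 hc
    (fun t ht => by
      rw [hAB t (hsub ht)]
      exact mul_le_mul_of_nonneg_right (hcle t ht) (sq_nonneg t))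
    (by
      simp only [hf0]
      rw [div_lt_iff₀ hl2] at k1
      simp
      linarith)
  refine ⟨κ1, μ0, κ, min_le_left _ _, k2, fun μ1 hμ1 => ⟨(H μ1 hμ1).1, fun μ hμ => ?_⟩⟩
  obtain ⟨h1, h2, v, h, S, hv⟩ := (H μ1 hμ1).2 μ hμ
  exact ⟨h1, h2, radial_state hl hrp hrmax hRmono hRim hRderiv hRtop hxmax hRxmax hb1 hs hs2 S hv⟩

/-! ## Prüfer angle for the angular equation -/

set_option maxHeartbeats 1000000 in
lemma prufer_zero {b c : ℝ} {Δ k : ℝ → ℝ} {Q S h : ℝ → ℝ → ℝ} (hb : π / 2 < b) (hbπ : b < π)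
    (hΔ : Continuous Δ) (hΔ0 : ∀ t, 0 ≤ t → t < π → 0 < Δ t) (hΔ1 : ∀ t, Δ t ≤ 1)
    (hk : Continuous k) (hk0 : ∀ p, 0 < k p) (hkt : Tendsto k atTop atTop)
    (hc : 0 < c) (hc1 : c ≤ 1)
    (hQc : ContinuousOn (fun z : ℝ × ℝ => Q z.1 z.2) (univ ×ˢ Icc 0 (π / 2)))
    (hQ : ∀ p t, 0 ≤ t → t < π → c * k p ^ 2 ≤ Q p t)
    (hS : Continuous (fun z : ℝ × ℝ => S z.1 z.2)) (hh : Continuous (fun z : ℝ × ℝ => h z.1 z.2))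
    (hS0 : ∀ p, S p 0 = 1) (hnd : ∀ p, ∀ t ∈ Ioo 0 b, S p t = 0 → h p t = 0 → False)
    (dS : ∀ p, ∀ t ∈ Ioo 0 b, HasDerivAt (S p) (h p t) t)
    (dw : ∀ p, ∀ t ∈ Ioo 0 b, HasDerivAt (fun t => sin t * Δ t * h p t) (-(sin t * Q p t * S p t)) t) :
    ∀ L, ∃ p, L ≤ p ∧ S p (π / 2) = 0 := by
  have hπ : 0 < π / 2 := by positivity
  set w : ℝ → ℝ → ℝ := fun p t => sin t * Δ t * h p t with hw
  have wc : Continuous (fun z : ℝ × ℝ => w z.1 z.2) := by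
    simp only [hw]; fun_prop
  have dw' : ∀ p, ∀ t ∈ Ioo 0 b, HasDerivAt (w p) (-(sin t * Q p t * S p t)) t := dw
  have w0 : ∀ p, w p 0 = 0 := fun p => by simp [hw]
  clear_value w
  set Den : ℝ → ℝ → ℝ := fun p t => S p t ^ 2 + (w p t / k p) ^ 2 with hDen
  set Num : ℝ → ℝ → ℝ := fun p t => sin t * Q p t * S p t ^ 2 / k p + w p t * h p t / k p with hNum
  have Dpos' : ∀ p, ∀ t ∈ Icc 0 (π / 2), 0 < Den p t := by
    intro p t ht
    have h0 : 0 ≤ Den p t := by simp only [hDen]; positivity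
    refine lt_of_le_of_ne h0 (fun e => ?_)
    have e1 : S p t = 0 := by
      simp only [hDen] at e
      nlinarith [sq_nonneg (S p t), sq_nonneg (w p t / k p)]
    have e2 : w p t / k p = 0 := by
      simp only [hDen] at e
      nlinarith [sq_nonneg (S p t), sq_nonneg (w p t / k p)]
    rcases ht.1.eq_or_lt with h1 | h1
    · rw [← h1, hS0] at e1; norm_num at e1
    · refine hnd p t ⟨h1, ht.2.trans_lt hb⟩ e1 ?_
      have hs : 0 < sin t := sin_pos_of_pos_of_lt_pi h1 (by linarith [ht.2])
      have hd := hΔ0 t h1.le (by linarith [ht.2])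
      rw [div_eq_zero_iff] at e2
      rcases e2 with e2 | e2
      · simp only [hw] at e2
        rcases mul_eq_zero.1 e2 with e3 | e3
        · exact absurd e3 (mul_pos hs hd).ne'
        · exact e3
      · exact absurd e2 (hk0 p).ne'
  set N : ℝ → ℝ → ℝ := fun p t => Num p t / Den p t with hN
  have kc : ContinuousOn (fun z : ℝ × ℝ => k z.1) (univ ×ˢ Icc 0 (π / 2)) := by fun_prop
  have k0 : ∀ z : ℝ × ℝ, z ∈ (univ ×ˢ Icc 0 (π / 2) : Set (ℝ × ℝ)) → k z.1 ≠ 0 := fun z _ => (hk0 _).ne'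
  have Numc : ContinuousOn (fun z : ℝ × ℝ => Num z.1 z.2) (univ ×ˢ Icc 0 (π / 2)) := by
    have s1 : ContinuousOn (fun z : ℝ × ℝ => sin z.2) (univ ×ˢ Icc 0 (π / 2)) := by fun_prop
    have s2 : ContinuousOn (fun z : ℝ × ℝ => sin z.2 * Q z.1 z.2 * S z.1 z.2 ^ 2) (univ ×ˢ Icc 0 (π / 2)) :=
      (s1.mul hQc).mul (hS.continuousOn.pow 2)
    have s3 : ContinuousOn (fun z : ℝ × ℝ => w z.1 z.2 * h z.1 z.2) (univ ×ˢ Icc 0 (π / 2)) :=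
      (wc.mul hh).continuousOn
    have s4 := s2.div kc k0
    have s5 := s3.div kc k0
    exact s4.add s5
  have Denc : ContinuousOn (fun z : ℝ × ℝ => Den z.1 z.2) (univ ×ˢ Icc 0 (π / 2)) :=
    ContinuousOn.add (hS.continuousOn.pow 2) (ContinuousOn.pow (ContinuousOn.div wc.continuousOn kc k0) 2)
  have Nc : ContinuousOn (fun z : ℝ × ℝ => N z.1 z.2) (univ ×ˢ Icc 0 (π / 2)) :=
    Numc.div Denc (fun z hz => (Dpos' _ _ hz.2).ne')
  clear_value N
  have Ncl : Continuous (fun z : ℝ × ℝ => N z.1 (clp (π / 2) z.2)) := by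
    have : Continuous (fun z : ℝ × ℝ => ((z.1, clp (π / 2) z.2) : ℝ × ℝ)) :=
      continuous_fst.prodMk ((clp_cont _).comp continuous_snd)
    have hm : ∀ z : ℝ × ℝ, ((z.1, clp (π / 2) z.2) : ℝ × ℝ) ∈ (univ ×ˢ Icc 0 (π / 2) : Set (ℝ × ℝ)) :=
      fun z => ⟨mem_univ _, clp_mem hπ.le _⟩
    exact ContinuousOn.comp_continuous Nc this hm
  set φ : ℝ → ℝ → ℝ := fun p t => ∫ s in (0:ℝ)..t, N p (clp (π / 2) s) with hφ
  have Np : ∀ p, Continuous (fun t => N p (clp (π / 2) t)) := fun p =>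
    Ncl.comp (Continuous.prodMk_right p)
  have dφ : ∀ p, ∀ t ∈ Icc 0 (π / 2), HasDerivAt (φ p) (N p t) t := by
    intro p t ht
    have := (Np p).integral_hasStrictDerivAt 0 t
    have := this.hasDerivAt
    rwa [clp_eq ht.1 ht.2] at this
  have φc : Continuous (fun p => φ p (π / 2)) :=
    intervalIntegral.continuous_parametric_intervalIntegral_of_continuous' (f := fun p s => N p (clp (π / 2) s)) Ncl 0 (π / 2)
  have Nlow : ∀ p, ∀ t ∈ Icc 0 (π / 2), c * k p * sin t ≤ N p t := by
    intro p t ht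
    simp only [hN]
    rw [le_div_iff₀ (Dpos' p t ht)]
    have hs : 0 ≤ sin t := sin_nonneg_of_nonneg_of_le_pi ht.1 (by linarith [ht.2])
    have hs1 : sin t ≤ 1 := sin_le_one t
    have hd := hΔ0 t ht.1 (by linarith [ht.2])
    have hd1 := hΔ1 t
    have hkp := hk0 p
    have a1 : c * k p * sin t * S p t ^ 2 ≤ sin t * Q p t * S p t ^ 2 / k p := by
      rw [le_div_iff₀ hkp]
      have := mul_le_mul_of_nonneg_left (hQ p t ht.1 (by linarith [ht.2])) (mul_nonneg hs (sq_nonneg (S p t)))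
      nlinarith
    have a2 : c * k p * sin t * (w p t / k p) ^ 2 ≤ w p t * h p t / k p := by
      have e : c * k p * sin t * (w p t / k p) ^ 2 = c * sin t * w p t ^ 2 / k p := by field_simp
      rw [e]
      apply div_le_div_of_nonneg_right _ hkp.le
      simp only [hw]
      have e2 : sin t * Δ t * h p t * h p t - c * sin t * (sin t * Δ t * h p t) ^ 2 =
        sin t * Δ t * h p t ^ 2 * (1 - c * sin t ^ 2 * Δ t) := by ring
      have e3 : c * sin t ^ 2 * Δ t ≤ 1 := by
        have : sin t ^ 2 ≤ 1 := sin_sq_le_one t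
        have h1 : c * sin t ^ 2 ≤ 1 := by nlinarith [sq_nonneg (sin t)]
        nlinarith [mul_nonneg hc.le (sq_nonneg (sin t))]
      have e4 : 0 ≤ sin t * Δ t * h p t ^ 2 * (1 - c * sin t ^ 2 * Δ t) := by
        have := sub_nonneg.2 e3
        positivity
      linarith
    simp only [hDen, hNum]
    linarith
  have φlow : ∀ p, c * k p ≤ φ p (π / 2) := by
    intro p
    have e : c * k p = ∫ s in (0:ℝ)..(π / 2), c * k p * sin s := by
      rw [intervalIntegral.integral_const_mul, integral_sin]; simp
    rw [e]
    apply intervalIntegral.integral_mono_on hπ.le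
    · exact (by fun_prop : Continuous fun s => c * k p * sin s).intervalIntegrable _ _
    · exact (Np p).intervalIntegrable _ _
    · intro t ht
      rw [clp_eq ht.1 ht.2]
      exact Nlow p t ht
  have φ0 : ∀ p, φ p 0 = 0 := fun p => by simp [hφ]
  clear_value φ
  have hD : ∀ p, S p (π / 2) * sin (φ p (π / 2)) + w p (π / 2) / k p * cos (φ p (π / 2)) = 0 := by
    intro p
    set D : ℝ → ℝ := fun t => S p t * sin (φ p t) + w p t / k p * cos (φ p t) with hDd
    have Sp : Continuous (S p) := hS.comp (Continuous.prodMk_right p)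
    have wp : Continuous (w p) := wc.comp (Continuous.prodMk_right p)
    have φp : ContinuousOn (φ p) (Icc 0 (π / 2)) := fun t ht => (dφ p t ht).continuousAt.continuousWithinAt
    have Dc : ContinuousOn D (Icc 0 (π / 2)) :=
      (Sp.continuousOn.mul (continuous_sin.comp_continuousOn φp)).add
        ((wp.div_const _).continuousOn.mul (continuous_cos.comp_continuousOn φp))
    have Denp : ContinuousOn (Den p) (Icc 0 (π / 2)) :=
      ((Sp.pow 2).add ((wp.div_const _).pow 2)).continuousOn
    have Gc : ContinuousOn (fun t => D t ^ 2 / Den p t) (Icc 0 (π / 2)) :=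
      (Dc.pow 2).div Denp (fun t ht => (Dpos' p t ht).ne')
    have Gd : ∀ t ∈ Ioo 0 (π / 2), HasDerivAt (fun t => D t ^ 2 / Den p t) 0 t := by
      intro t ht
      have ht' : t ∈ Ioo 0 b := ⟨ht.1, ht.2.trans hb⟩
      have htc := Ioo_subset_Icc_self ht
      have d1 := dS p t ht'
      have d2 : HasDerivAt (fun t => w p t / k p) (-(sin t * Q p t * S p t) / k p) t := (dw' p t ht').div_const _
      have d3 := dφ p t htc
      have d4 : HasDerivAt D (h p t * sin (φ p t) + S p t * (cos (φ p t) * N p t) +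
          (-(sin t * Q p t * S p t) / k p * cos (φ p t) + w p t / k p * (-sin (φ p t) * N p t))) t :=
        (d1.mul d3.sin).add (d2.mul d3.cos)
      have d5 : HasDerivAt (Den p) (2 * S p t * h p t + 2 * (w p t / k p) * (-(sin t * Q p t * S p t) / k p)) t := by
        refine ((d1.pow 2).add (d2.pow 2)).congr_deriv ?_
        simp
      have d0 := (Dpos' p t htc)
      refine ((d4.pow 2).div d5 d0.ne').congr_deriv ?_
      have hkp := (hk0 p).ne'
      have eN : N p t * Den p t = Num p t := by simp only [hN]; field_simp
      have num0 : (h p t * sin (φ p t) + S p t * (cos (φ p t) * N p t) +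
          (-(sin t * Q p t * S p t) / k p * cos (φ p t) + w p t / k p * (-sin (φ p t) * N p t))) * Den p t =
          D t * (S p t * h p t + (w p t / k p) * (-(sin t * Q p t * S p t) / k p)) := by
        have : (h p t * sin (φ p t) + S p t * (cos (φ p t) * N p t) +
          (-(sin t * Q p t * S p t) / k p * cos (φ p t) + w p t / k p * (-sin (φ p t) * N p t))) * Den p t =
          (h p t * sin (φ p t) + (-(sin t * Q p t * S p t) / k p * cos (φ p t))) * Den p t +
          (S p t * cos (φ p t) - w p t / k p * sin (φ p t)) * (N p t * Den p t) := by ring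
        rw [this, eN]
        simp only [hDen, hNum, hDd]
        field_simp
        ring
      rw [div_eq_zero_iff]
      left
      simp only [Pi.pow_apply]
      push_cast
      linear_combination 2 * D t * num0
    obtain ⟨t, ht, e⟩ := exists_hasDerivAt_eq_slope _ _ hπ Gc Gd
    have e0 : D 0 = 0 := by
      simp [hDd, φ0, w0]
    rw [e0, eq_comm, div_eq_zero_iff] at e
    rcases e with e | e
    · have d0 := Dpos' p (π / 2) ⟨hπ.le, le_rfl⟩
      have e1 : D (π / 2) ^ 2 / Den p (π / 2) = 0 := by simpa using e
      rw [div_eq_zero_iff] at e1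
      rcases e1 with e1 | e1
      · exact pow_eq_zero_iff (two_ne_zero) |>.1 e1
      · exact absurd e1 d0.ne'
    · linarith
  intro L
  obtain ⟨n, hn⟩ := exists_nat_ge (φ L (π / 2) / π)
  have hn' : φ L (π / 2) ≤ π / 2 + n * π := by
    rw [div_le_iff₀ pi_pos] at hn; linarith
  obtain ⟨p2, hp2, hp2'⟩ := ((hkt.eventually_ge_atTop ((π / 2 + n * π) / c)).and (eventually_ge_atTop L)).exists
  have hge : π / 2 + n * π ≤ φ p2 (π / 2) := by
    refine le_trans ?_ (φlow p2)
    rw [div_le_iff₀ hc] at hp2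
    linarith
  obtain ⟨p, hp, e⟩ := intermediate_value_Icc hp2' φc.continuousOn ⟨hn', hge⟩
  refine ⟨p, hp.1, ?_⟩
  have := hD p
  simp only at e
  rw [e] at this
  have c0 : cos (π / 2 + n * π) = 0 := by
    rw [cos_add_nat_mul_pi]; simp
  have s0 : sin (π / 2 + n * π) ≠ 0 := by
    rw [sin_add_nat_mul_pi]; simp
  rw [c0, mul_zero, add_zero] at this
  exact (mul_eq_zero.1 this).resolve_right s0

/-! ## Odd extension of the angular solution -/

lemma smooth_pair {O : Set ℝ} (hO : IsOpen O) {A B X Z : ℝ → ℝ} (hA : ContDiffOn ℝ (⊤ : ℕ∞) A O)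
    (hB : ContDiffOn ℝ (⊤ : ℕ∞) B O) (dX : ∀ t ∈ O, HasDerivAt X (A t * Z t) t)
    (dZ : ∀ t ∈ O, HasDerivAt Z (B t * X t) t) : ContDiffOn ℝ (⊤ : ℕ∞) X O := by
  have key : ∀ n : ℕ, ContDiffOn ℝ n X O ∧ ContDiffOn ℝ n Z O := by
    intro n
    induction n with
    | zero =>
      refine ⟨?_, ?_⟩
      · exact contDiffOn_zero.2 (fun t ht => (dX t ht).continuousAt.continuousWithinAt)
      · exact contDiffOn_zero.2 (fun t ht => (dZ t ht).continuousAt.continuousWithinAt)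
    | succ n ih =>
      have hA' : ContDiffOn ℝ n A O := contDiffOn_infty.1 hA n
      have hB' : ContDiffOn ℝ n B O := contDiffOn_infty.1 hB n
      push_cast
      refine ⟨?_, ?_⟩
      · rw [contDiffOn_succ_iff_deriv_of_isOpen hO]
        refine ⟨fun t ht => (dX t ht).differentiableAt.differentiableWithinAt, by simp, ?_⟩
        exact (hA'.mul ih.2).congr (fun t ht => (dX t ht).deriv)
      · rw [contDiffOn_succ_iff_deriv_of_isOpen hO]
        refine ⟨fun t ht => (dZ t ht).differentiableAt.differentiableWithinAt, by simp, ?_⟩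
        exact (hB'.mul ih.1).congr (fun t ht => (dZ t ht).deriv)
  exact contDiffOn_infty.2 (fun n => (key n).1)

lemma angular_extend {b : ℝ} {Δ Q S h : ℝ → ℝ} (hb : π / 2 < b) (hbπ : b < π)
    (hΔ : ContDiffOn ℝ (⊤ : ℕ∞) Δ (Ioo 0 π)) (hΔ0 : ∀ t ∈ Ioo 0 π, 0 < Δ t) (hΔs : ∀ t, Δ (π - t) = Δ t)
    (hQ : ContDiffOn ℝ (⊤ : ℕ∞) Q (Ioo 0 π)) (hQs : ∀ t, Q (π - t) = Q t)
    (hS : Continuous S) (hh : Continuous h) (hS0 : S 0 = 1) (hSe : S (π / 2) = 0)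
    (dS : ∀ t ∈ Ioo 0 b, HasDerivAt S (h t) t)
    (dw : ∀ t ∈ Ioo 0 b, HasDerivAt (fun t => sin t * Δ t * h t) (-(sin t * Q t * S t)) t) :
    ∃ T : ℝ → ℝ, (∃ θ ∈ Ioo 0 π, T θ ≠ 0) ∧ ContDiffOn ℝ (⊤ : ℕ∞) T (Ioo 0 π) ∧
      (∃ C : ℝ, ∀ θ ∈ Ioo 0 π, |T θ| ≤ C) ∧
      (∀ θ ∈ Ioo 0 π, HasDerivAt (fun t => Δ t * sin t * deriv T t) (-(sin θ * Q θ * T θ)) θ) ∧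
      Tendsto (fun θ => sin θ * deriv T θ) (𝓝[>] 0) (𝓝 0) ∧
      Tendsto (fun θ => sin θ * deriv T θ) (𝓝[<] π) (𝓝 0) := by
  have hπ := pi_pos
  have sinp : ∀ t ∈ Ioo 0 π, 0 < sin t := fun t ht => sin_pos_of_pos_of_lt_pi ht.1 ht.2
  have p0 : ∀ t ∈ Ioo 0 π, sin t * Δ t ≠ 0 := fun t ht => (mul_pos (sinp t ht) (hΔ0 t ht)).ne'
  have sinc : ContDiffOn ℝ (⊤ : ℕ∞) sin (Ioo 0 π) := contDiff_sin.contDiffOn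
  have hA : ContDiffOn ℝ (⊤ : ℕ∞) (fun t => (sin t * Δ t)⁻¹) (Ioo 0 π) := (sinc.mul hΔ).inv p0
  have hB : ContDiffOn ℝ (⊤ : ℕ∞) (fun t => -(sin t * Q t)) (Ioo 0 π) := (sinc.mul hQ).neg
  set w : ℝ → ℝ := fun t => sin t * Δ t * h t with hw
  -- reflected solution
  have dS' : ∀ t ∈ Ioo (π - b) π, HasDerivAt (fun t => -S (π - t)) (h (π - t)) t := by
    intro t ht
    have h1 : HasDerivAt (fun t => π - t) (-1) t := by simpa using (hasDerivAt_id t).const_sub π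
    have := ((dS (π - t) ⟨by linarith [ht.2], by linarith [ht.1]⟩).comp t h1).neg
    refine this.congr_deriv (by ring)
  have dw' : ∀ t ∈ Ioo (π - b) π, HasDerivAt (fun t => w (π - t)) (-(sin t * Q t * (-S (π - t)))) t := by
    intro t ht
    have h1 : HasDerivAt (fun t => π - t) (-1) t := by simpa using (hasDerivAt_id t).const_sub π
    have := ((dw (π - t) ⟨by linarith [ht.2], by linarith [ht.1]⟩).comp t h1)
    refine this.congr_deriv ?_
    rw [sin_pi_sub, hQs]; ring
  have hsub : Ioo (π - b) b ⊆ Ioo 0 π := Ioo_subset_Ioo (by linarith) hbπ.le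
  have key := linear_unique (a := π - b) (b := b) (c := π / 2) (A := fun t => (sin t * Δ t)⁻¹)
    (B := fun t => -(sin t * Q t)) (X := fun t => S t - -S (π - t)) (Z := fun t => w t - w (π - t))
    (hA.continuousOn.mono hsub) (hB.continuousOn.mono hsub)
    (fun t ht => by
      refine ((dS t ⟨(hsub ht).1, ht.2⟩).sub (dS' t ⟨ht.1, (hsub ht).2⟩)).congr_deriv ?_
      simp only [hw]
      rw [sin_pi_sub, hΔs, ← mul_sub, ← mul_assoc, inv_mul_cancel₀ (p0 t (hsub ht)), one_mul])
    (fun t ht => by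
      refine ((dw t ⟨(hsub ht).1, ht.2⟩).sub (dw' t ⟨ht.1, (hsub ht).2⟩)).congr_deriv ?_
      ring)
    ⟨by linarith, hb⟩
    (by rw [show π - π / 2 = π / 2 by ring, hSe]; simp)
    (by rw [show π - π / 2 = π / 2 by ring]; simp)
  have ov1 : ∀ t ∈ Ioo (π - b) b, S t = -S (π - t) := fun t ht => sub_eq_zero.1 (key t ht).1
  have ov2 : ∀ t ∈ Ioo (π - b) b, h t = h (π - t) := by
    intro t ht
    have := sub_eq_zero.1 (key t ht).2
    simp only [hw] at this
    rw [sin_pi_sub, hΔs] at this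
    exact mul_left_cancel₀ (p0 t (hsub ht)) this
  set T : ℝ → ℝ := fun t => if t ≤ π / 2 then S t else -S (π - t) with hT
  set H : ℝ → ℝ := fun t => if t ≤ π / 2 then h t else h (π - t) with hH
  have T1 : ∀ t ∈ Ioo 0 b, T t = S t := by
    intro t ht
    by_cases hc : t ≤ π / 2
    · simp [hT, hc]
    · simp only [hT, hc, if_false]; exact (ov1 t ⟨by linarith, ht.2⟩).symm
  have H1 : ∀ t ∈ Ioo 0 b, H t = h t := by
    intro t ht
    by_cases hc : t ≤ π / 2
    · simp [hH, hc]
    · simp only [hH, hc, if_false]; exact (ov2 t ⟨by linarith, ht.2⟩).symm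
  have T2 : ∀ t ∈ Ioo (π - b) π, T t = -S (π - t) := by
    intro t ht
    by_cases hc : t ≤ π / 2
    · simp only [hT, hc, if_true]; exact ov1 t ⟨ht.1, by linarith⟩
    · simp [hT, hc]
  have H2 : ∀ t ∈ Ioo (π - b) π, H t = h (π - t) := by
    intro t ht
    by_cases hc : t ≤ π / 2
    · simp only [hH, hc, if_true]; exact ov2 t ⟨ht.1, by linarith⟩
    · simp [hH, hc]
  have cover : ∀ t ∈ Ioo 0 π, t ∈ Ioo 0 b ∨ t ∈ Ioo (π - b) π := by
    intro t ht
    rcases lt_or_ge t b with h | h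
    · exact Or.inl ⟨ht.1, h⟩
    · exact Or.inr ⟨by linarith, ht.2⟩
  have dT : ∀ t ∈ Ioo 0 π, HasDerivAt T (H t) t := by
    intro t ht
    rcases cover t ht with ht | ht
    · rw [H1 t ht]
      refine (dS t ht).congr_of_eventuallyEq ?_
      filter_upwards [Ioo_mem_nhds ht.1 ht.2] with y hy using T1 y hy
    · rw [H2 t ht]
      refine (dS' t ht).congr_of_eventuallyEq ?_
      filter_upwards [Ioo_mem_nhds ht.1 ht.2] with y hy using T2 y hy
  have dW : ∀ t ∈ Ioo 0 π, HasDerivAt (fun t => sin t * Δ t * H t) (-(sin t * Q t * T t)) t := by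
    intro t ht
    rcases cover t ht with ht | ht
    · rw [T1 t ht]
      refine (dw t ht).congr_of_eventuallyEq ?_
      filter_upwards [Ioo_mem_nhds ht.1 ht.2] with y hy
      rw [H1 y hy]
    · rw [T2 t ht]
      refine (dw' t ht).congr_of_eventuallyEq ?_
      filter_upwards [Ioo_mem_nhds ht.1 ht.2] with y hy
      simp only [hw]
      rw [H2 y hy, sin_pi_sub, hΔs]
  have derT : ∀ t ∈ Ioo 0 π, deriv T t = H t := fun t ht => (dT t ht).deriv
  refine ⟨T, ?_, ?_, ?_, ?_, ?_, ?_⟩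
  · have hev : ∀ᶠ t in 𝓝[>] (0:ℝ), 0 < S t :=
      (hS.continuousAt.eventually (lt_mem_nhds (by rw [hS0]; exact one_pos))).filter_mono nhdsWithin_le_nhds
    have h2 : ∀ᶠ x in 𝓝[>] (0:ℝ), x ∈ Ioo 0 b := Ioo_mem_nhdsGT (by linarith)
    obtain ⟨x, hx1, hx2⟩ := (hev.and h2).exists
    refine ⟨x, ⟨hx2.1, hx2.2.trans hbπ⟩, ?_⟩
    rw [T1 x hx2]; exact hx1.ne'
  · refine smooth_pair isOpen_Ioo (Z := fun t => sin t * Δ t * H t) hA hB (fun t ht => ?_) (fun t ht => ?_)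
    · refine (dT t ht).congr_deriv ?_
      rw [← mul_assoc, inv_mul_cancel₀ (p0 t ht), one_mul]
    · exact (dW t ht).congr_deriv (by ring)
  · obtain ⟨C, hC⟩ := (isCompact_Icc (a := (0:ℝ)) (b := π / 2)).exists_bound_of_continuousOn hS.continuousOn
    refine ⟨C, fun t ht => ?_⟩
    by_cases hc : t ≤ π / 2
    · simp only [hT, hc, if_true]; exact hC t ⟨ht.1.le, hc⟩
    · simp only [hT, hc, if_false, abs_neg]; exact hC _ ⟨by linarith [ht.2], by linarith⟩
  · intro t ht
    refine (dW t ht).congr_of_eventuallyEq ?_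
    filter_upwards [Ioo_mem_nhds ht.1 ht.2] with y hy
    rw [derT y hy]; ring
  · have h2 : ∀ᶠ x in 𝓝[>] (0:ℝ), x ∈ Ioo 0 b := Ioo_mem_nhdsGT (by linarith)
    have : Tendsto (fun t => sin t * h t) (𝓝[>] 0) (𝓝 0) := by
      have h3 : Continuous fun t => sin t * h t := by fun_prop
      have := h3.tendsto 0
      simp only [sin_zero, zero_mul] at this
      exact this.mono_left nhdsWithin_le_nhds
    refine this.congr' ?_
    filter_upwards [h2] with x hx
    rw [derT x ⟨hx.1, hx.2.trans hbπ⟩, H1 x hx]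
  · have h2 : ∀ᶠ x in 𝓝[<] π, x ∈ Ioo (π - b) π := Ioo_mem_nhdsLT (by linarith)
    have : Tendsto (fun t => sin t * h (π - t)) (𝓝[<] π) (𝓝 0) := by
      have h3 : Continuous fun t => sin t * h (π - t) := by fun_prop
      have := h3.tendsto π
      simp only [sin_pi, zero_mul] at this
      exact this.mono_left nhdsWithin_le_nhds
    refine this.congr' ?_
    filter_upwards [h2] with x hx
    rw [derT x ⟨by linarith [hx.1], hx.2⟩, H2 x hx]

lemma t_mul_sinc (t : ℝ) : t * Real.sinc t = sin t := by
  by_cases h : t = 0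
  · simp [h]
  · rw [Real.sinc_of_ne_zero h]; field_simp

lemma angular_main {l a α κ1 μ1 : ℝ} {κ : ℝ → ℝ} (hl : 0 < l) (ha : |a| < l) (hκ1 : a ^ 2 * κ1 < 1)
    (hκc : Continuous (fun μ => κ (max μ1 μ))) (hκ : ∀ μ, μ1 ≤ μ → 0 < κ μ ∧ κ μ ≤ κ1)
    (hμ1 : 1 ≤ μ1) (hμ1' : |α| / l ^ 2 * a ^ 2 ≤ (1 - a ^ 2 * κ1) / 2 * μ1) (L : ℝ) :
    ∃ μ, μ1 ≤ μ ∧ L ≤ μ ∧ ∃ T : ℝ → ℝ, 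
        (∃ θ ∈ Set.Ioo (0:ℝ) π, T θ ≠ 0) ∧
        ContDiffOn ℝ (⊤ : ℕ∞) T (Set.Ioo (0:ℝ) π) ∧
        (∃ C : ℝ, ∀ θ ∈ Set.Ioo (0:ℝ) π, |T θ| ≤ C) ∧
        (∀ θ ∈ Set.Ioo (0:ℝ) π,
          -(1 / Real.sin θ) * deriv (fun t =>
              (1 - (a^2/l^2) * (Real.cos t)^2) * Real.sin t * deriv T t) θ
            + (|α|/l^2) * a^2
              * (if 0 < α then (Real.sin θ)^2 else (Real.cos θ)^2) * T θ
            + ((Real.sin θ)^2 / (1 - (a^2/l^2) * (Real.cos θ)^2)) * a^2 * (κ μ * μ) * T θ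
          = μ * T θ) ∧
        Filter.Tendsto (fun θ => Real.sin θ * deriv T θ)
          (nhdsWithin 0 (Set.Ioi 0)) (nhds 0) ∧
        Filter.Tendsto (fun θ => Real.sin θ * deriv T θ)
          (nhdsWithin π (Set.Iio π)) (nhds 0) := by
  have hπ := pi_pos
  have hal : a ^ 2 < l ^ 2 := sq_lt_sq' (by linarith [neg_abs_le a]) (lt_of_abs_lt ha)
  have hl2 : 0 < l ^ 2 := by positivity
  have hratio : a ^ 2 / l ^ 2 < 1 := (div_lt_one hl2).2 hal
  have hratio0 : 0 ≤ a ^ 2 / l ^ 2 := by positivity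
  have hκ1p : 0 < κ1 := (hκ μ1 le_rfl).1.trans_le (hκ μ1 le_rfl).2
  set Δ : ℝ → ℝ := fun t => 1 - (a^2/l^2) * (Real.cos t)^2 with hΔ
  have Δpos : ∀ t, 0 < Δ t := by
    intro t
    simp only [hΔ]
    nlinarith [cos_sq_le_one t, sq_nonneg (cos t)]
  have Δ1 : ∀ t, Δ t ≤ 1 := by
    intro t
    simp only [hΔ]
    nlinarith [sq_nonneg (cos t)]
  have Δs : ∀ t, sin t ^ 2 / Δ t ≤ 1 := by
    intro t
    rw [div_le_one (Δpos t)]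
    simp only [hΔ]
    nlinarith [sin_sq_add_cos_sq t, sq_nonneg (cos t)]
  have Δsm : ContDiff ℝ (⊤ : ℕ∞) Δ := by
    simp only [hΔ]
    exact contDiff_const.sub (contDiff_const.mul (contDiff_cos.pow 2))
  have Δc : Continuous Δ := Δsm.continuous
  set c : ℝ → ℝ := fun t => if 0 < α then (Real.sin t)^2 else (Real.cos t)^2 with hc
  have csm : ContDiff ℝ (⊤ : ℕ∞) c := by
    by_cases h : 0 < α
    · simp only [hc, h, if_true]; exact contDiff_sin.pow 2
    · simp only [hc, h, if_false]; exact contDiff_cos.pow 2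
  have cle : ∀ t, c t ≤ 1 := by
    intro t
    by_cases h : 0 < α
    · simp only [hc, h, if_true]; exact sin_sq_le_one t
    · simp only [hc, h, if_false]; exact cos_sq_le_one t
  have cs : ∀ t, c (π - t) = c t := by
    intro t
    simp [hc, sin_pi_sub, cos_pi_sub]
  set C := |α| / l ^ 2 * a ^ 2 with hC
  have C0 : 0 ≤ C := by positivity
  set Λ : ℝ → ℝ := fun p => max μ1 p with hΛ
  have Λc : Continuous Λ := by simp only [hΛ]; fun_prop
  have Λ1 : ∀ p, μ1 ≤ Λ p := fun p => le_max_left _ _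
  have Λ0 : ∀ p, 0 < Λ p := fun p => by linarith [Λ1 p]
  have κΛc : Continuous (fun p => κ (Λ p)) := hκc
  set Q : ℝ → ℝ → ℝ := fun p t => Λ p - (C * c t + sin t ^ 2 / Δ t * a ^ 2 * (κ (Λ p) * Λ p)) with hQ
  have Qlow : ∀ p t, (1 - a ^ 2 * κ1) / 2 * Λ p ≤ Q p t := by
    intro p t
    have h1 : C * c t ≤ (1 - a ^ 2 * κ1) / 2 * Λ p := by
      have e1 : C * c t ≤ C := mul_le_of_le_one_right C0 (cle t)
      have e2 : (1 - a ^ 2 * κ1) / 2 * μ1 ≤ (1 - a ^ 2 * κ1) / 2 * Λ p :=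
        mul_le_mul_of_nonneg_left (Λ1 p) (by linarith)
      linarith
    have h2 : sin t ^ 2 / Δ t * a ^ 2 * (κ (Λ p) * Λ p) ≤ a ^ 2 * κ1 * Λ p := by
      have hk := hκ _ (Λ1 p)
      have e0 : 0 ≤ a ^ 2 * (κ (Λ p) * Λ p) := mul_nonneg (sq_nonneg a) (mul_pos hk.1 (Λ0 p)).le
      have e1 := mul_le_mul_of_nonneg_right (Δs t) e0
      have e2 : a ^ 2 * (κ (Λ p) * Λ p) ≤ a ^ 2 * (κ1 * Λ p) :=
        mul_le_mul_of_nonneg_left (mul_le_mul_of_nonneg_right hk.2 (Λ0 p).le) (sq_nonneg a)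
      nlinarith
    simp only [hQ]
    linarith
  have Qc : Continuous (fun z : ℝ × ℝ => Q z.1 z.2) := by
    have h1 : Continuous fun z : ℝ × ℝ => Λ z.1 := Λc.comp continuous_fst
    have h2 : Continuous fun z : ℝ × ℝ => κ (Λ z.1) := κΛc.comp continuous_fst
    have h3 : Continuous fun z : ℝ × ℝ => c z.2 := csm.continuous.comp continuous_snd
    have h4 : Continuous fun z : ℝ × ℝ => Δ z.2 := Δc.comp continuous_snd
    have h5 : Continuous fun z : ℝ × ℝ => sin z.2 ^ 2 / Δ z.2 :=
      (by fun_prop : Continuous fun z : ℝ × ℝ => sin z.2 ^ 2).div h4 (fun z => (Δpos _).ne')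
    exact h1.sub ((continuous_const.mul h3).add ((h5.mul continuous_const).mul (h2.mul h1)))
  set b := 3 * π / 4 with hb
  have hb1 : π / 2 < b := by rw [hb]; linarith
  have hb2 : b < π := by rw [hb]; linarith
  have hb0 : 0 < b := by linarith
  set f : ℝ → ℝ := fun t => Real.sinc t * Δ t with hf
  have fc : Continuous f := Real.continuous_sinc.mul Δc
  have fpos : ∀ t ∈ Icc 0 b, 0 < f t := by
    intro t ht
    refine mul_pos ?_ (Δpos t)
    rcases ht.1.eq_or_lt with h | h
    · rw [← h, Real.sinc_zero]; exact one_pos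
    · rw [Real.sinc_of_ne_zero h.ne']
      exact div_pos (sin_pos_of_pos_of_lt_pi h (by linarith [ht.2])) h
  have qc : Continuous (fun z : ℝ × ℝ => -(Real.sinc z.2 * Q z.1 z.2)) :=
    ((Real.continuous_sinc.comp continuous_snd).mul Qc).neg
  obtain ⟨S, h, cS, ch, S0, h0, dS, dw⟩ := volterra (P := ℝ) (b := b) (β := 1) (f := f)
    (q := fun p t => -(Real.sinc t * Q p t)) hb0 zero_le_one fc.continuousOn fpos qc.continuousOn
  have Sol : ∀ p, SLSol b 1 f (fun t => -(Real.sinc t * Q p t)) (S p) (h p) := fun p =>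
    ⟨hb0, zero_le_one, fc.continuousOn, fpos, (qc.comp (Continuous.prodMk_right p)).continuousOn,
      cS.comp (Continuous.prodMk_right p), ch.comp (Continuous.prodMk_right p), S0 p, h0 p, dS p, dw p⟩
  have dw' : ∀ p, ∀ t ∈ Ioo 0 b, HasDerivAt (fun t => sin t * Δ t * h p t) (-(sin t * Q p t * S p t)) t := by
    intro p t ht
    have := dw p t ht
    have e : (fun t : ℝ => t ^ (1:ℝ) * f t * h p t) = fun t => sin t * Δ t * h p t := by
      funext t
      rw [rpow_one, ← t_mul_sinc t]; simp only [hf]; ring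
    rw [e] at this
    refine this.congr_deriv ?_
    rw [rpow_one, ← t_mul_sinc t]; ring
  have kt : Tendsto (fun p => √(Λ p)) atTop atTop :=
    Real.tendsto_sqrt_atTop.comp (tendsto_atTop_mono (fun p => le_max_right μ1 p) tendsto_id)
  obtain ⟨p, hp, hSp⟩ := prufer_zero (b := b) (c := (1 - a ^ 2 * κ1) / 2) (Δ := Δ) (k := fun p => √(Λ p)) (Q := Q)
    (S := S) (h := h) hb1 hb2 Δc (fun t _ _ => Δpos t) Δ1 (Real.continuous_sqrt.comp Λc)
    (fun p => Real.sqrt_pos.2 (Λ0 p)) kt (by linarith)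
    (by nlinarith [mul_nonneg (sq_nonneg a) hκ1p.le]) Qc.continuousOn
    (fun p t _ _ => by rw [Real.sq_sqrt (Λ0 p).le]; exact Qlow p t) cS ch S0
    (fun p t ht => (Sol p).no_double_zero ht) dS dw' (max μ1 L)
  have hΛp : Λ p = p := max_eq_right ((le_max_left _ _).trans hp)
  have Qsm : ContDiff ℝ (⊤ : ℕ∞) (Q p) := by
    have h5 : ContDiff ℝ (⊤ : ℕ∞) fun t => sin t ^ 2 / Δ t :=
      (contDiff_sin.pow 2).div Δsm (fun t => (Δpos t).ne')
    exact contDiff_const.sub ((contDiff_const.mul csm).add ((h5.mul contDiff_const).mul contDiff_const))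
  have Δsy : ∀ t, Δ (π - t) = Δ t := by intro t; simp [hΔ, cos_pi_sub]
  have Qsy : ∀ t, Q p (π - t) = Q p t := by
    intro t; simp only [hQ]; rw [cs, Δsy, sin_pi_sub]
  obtain ⟨T, T1, T2, T3, T4, T5, T6⟩ := angular_extend hb1 hb2 Δsm.contDiffOn (fun t _ => Δpos t) Δsy
    Qsm.contDiffOn Qsy (Sol p).vc (Sol p).hc (S0 p) hSp (dS p) (dw' p)
  refine ⟨p, (le_max_left _ _).trans hp, (le_max_right _ _).trans hp, T, T1, T2, T3, ?_, T5, T6⟩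
  intro θ hθ
  have e := (T4 θ hθ).deriv
  simp only [hΔ] at e
  rw [e]
  have hs := (sin_pos_of_pos_of_lt_pi hθ.1 hθ.2).ne'
  simp only [hQ, hΛp, hc, hC, hΔ]
  field_simp
  ring

/-- existence of sequences of bound states (uₙ, Sₙ) with frequencies ωₙ² and
angular eigenvalues μₙ → ∞ solving the coupled radial/angular eigenvalue problem, with the
uniform bounds 1/l² < ωₙ²/μₙ ≤ E + (V_max − E)/2. -/
theorem statement0 (M l a α : ℝ) (hM : 0 < M) (hl : 0 < l) (ha : |a| < l) (hα : α < 9/4)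
    (rp : ℝ) (hrp : 0 < rp) (hrp0 : Dm M l a rp = 0)
    (hrppos : ∀ r, rp < r → 0 < Dm M l a r)
    (rmax : ℝ) (hrmax : rp < rmax)
    (hmax : ∀ r ∈ Set.Ici rp, r ≠ rmax → Vsig M l a r < Vsig M l a rmax)
    (R : ℝ → ℝ) (hRmono : StrictMonoOn R (Set.Iio (π/2)))
    (hRim : R '' Set.Iio (π/2) = Set.Ioi rp)
    (hRderiv : ∀ x < π/2, HasDerivAt R (Dm M l a (R x) / ((R x)^2 + a^2)) x)
    (hRtop : Filter.Tendsto R (nhdsWithin (π/2) (Set.Iio (π/2))) Filter.atTop)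
    (xmax : ℝ) (hxmax : xmax < π/2) (hRxmax : R xmax = rmax)
    (E : ℝ) (hE : E ∈ Set.Ioo (1/l^2) (Vsig M l a rmax)) :
    ∃ (ω2 μ : ℕ → ℝ) (u : ℕ → ℝ → ℝ) (S : ℕ → ℝ → ℝ),
      -- (i) radial equation with Dirichlet condition and finite energy
      (∀ n,
        (∃ x ∈ Set.Ico xmax (π/2), u n x ≠ 0) ∧
        ContDiffOn ℝ 2 (u n) (Set.Ico xmax (π/2)) ∧
        (∀ x ∈ Set.Ioo xmax (π/2),
          -(deriv (deriv (u n)) x)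
            + (μ n * Vsig M l a (R x) + Vjunk M l a α (R x) + Vmass M l a α (R x)) * u n x
          = ω2 n * u n x) ∧
        u n xmax = 0 ∧
        MeasureTheory.IntegrableOn
          (fun x => (deriv (u n) x)^2 + (R x)^2 * (u n x)^2) (Set.Ioo xmax (π/2))) ∧
      -- (ii) angular equation with regularity conditions at the poles
      (∀ n,
        (∃ θ ∈ Set.Ioo (0:ℝ) π, S n θ ≠ 0) ∧
        ContDiffOn ℝ (⊤ : ℕ∞) (S n) (Set.Ioo (0:ℝ) π) ∧
        (∃ C : ℝ, ∀ θ ∈ Set.Ioo (0:ℝ) π, |S n θ| ≤ C) ∧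
        (∀ θ ∈ Set.Ioo (0:ℝ) π,
          -(1 / Real.sin θ) * deriv (fun t =>
              (1 - (a^2/l^2) * (Real.cos t)^2) * Real.sin t * deriv (S n) t) θ
            + (|α|/l^2) * a^2
              * (if 0 < α then (Real.sin θ)^2 else (Real.cos θ)^2) * S n θ
            + ((Real.sin θ)^2 / (1 - (a^2/l^2) * (Real.cos θ)^2)) * a^2 * ω2 n * S n θ
          = μ n * S n θ) ∧
        Filter.Tendsto (fun θ => Real.sin θ * deriv (S n) θ)
          (nhdsWithin 0 (Set.Ioi 0)) (nhds 0) ∧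
        Filter.Tendsto (fun θ => Real.sin θ * deriv (S n) θ)
          (nhdsWithin π (Set.Iio π)) (nhds 0)) ∧
      -- (iii) μₙ → ∞
      Filter.Tendsto μ Filter.atTop Filter.atTop ∧
      -- (iv) uniform bounds on ωₙ²/μₙ
      (∀ n, 1/l^2 < ω2 n / μ n ∧ ω2 n / μ n ≤ E + (Vsig M l a rmax - E) / 2) := by
  obtain ⟨κ1, μ0, κ, hκE, hκ1, H⟩ := radial_curve hM hl ha hα hrp hrp0 hrppos hrmax hRmono hRim hRderiv hRtop
    hxmax hRxmax hE
  have hd : 0 < (1 - a ^ 2 * κ1) / 2 := by linarith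
  set μ1 := max (max μ0 1) (|α| / l ^ 2 * a ^ 2 / ((1 - a ^ 2 * κ1) / 2)) with hμ1
  have m0 : μ0 ≤ μ1 := (le_max_left _ _).trans (le_max_left _ _)
  have m1 : 1 ≤ μ1 := (le_max_right _ _).trans (le_max_left _ _)
  have m2 : |α| / l ^ 2 * a ^ 2 ≤ (1 - a ^ 2 * κ1) / 2 * μ1 := by
    have : |α| / l ^ 2 * a ^ 2 / ((1 - a ^ 2 * κ1) / 2) ≤ μ1 := le_max_right _ _
    rw [div_le_iff₀ hd] at this
    linarith
  obtain ⟨hc, hr⟩ := H μ1 m0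
  have hl2 : 0 < 1 / l ^ 2 := by positivity
  have A := fun n : ℕ => angular_main hl ha hκ1 hc
    (fun μ hμ => ⟨hl2.trans (hr μ hμ).1, (hr μ hμ).2.1⟩) m1 m2 (n : ℝ)
  choose μ hμ hμn T hT using A
  have B := fun n => (hr (μ n) (hμ n)).2.2
  choose u hu using B
  refine ⟨fun n => κ (μ n) * μ n, μ, u, T, hu, hT,
    tendsto_atTop_mono hμn tendsto_natCast_atTop_atTop, fun n => ?_⟩
  have hp : μ n ≠ 0 := by linarith [hμ n]
  simp only
  rw [mul_div_assoc, div_self hp, mul_one]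
  refine ⟨(hr (μ n) (hμ n)).1, ?_⟩
  have := (hr (μ n) (hμ n)).2.1
  have := hE.2
  linarith
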